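/- arXiv:2504.15839 — 5 statements merged into one kernel-verified Lean document; each statement's English description precedes it below -/
import Mathlib

section
/- There exist absolute constants c, C > 0 such that for every positive integer N, one has c·N^10 ≤ 𝔠₃(N) ≤ C·N^10. -/
/-- The number of pairs `(A,B)` of `d × d` integer matrices with all entries in
`[-N, N]` such that `A * B = B * A`. -/
noncomputable def matCommCount (d N : ℕ) : ℕ :=
  Nat.card {AB : Matrix (Fin d) (Fin d) ℤ × Matrix (Fin d) (Fin d) ℤ //
    (∀ i j, |AB.1 i j| ≤ (N : ℤ)) ∧ (∀ i j, |AB.2 i j| ≤ (N : ℤ)) ∧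
    AB.1 * AB.2 = AB.2 * AB.1}

open Matrix Polynomial

/-- The `2 × 2` minors of an integer matrix all vanish. -/
def MinorsVanish (M : Matrix (Fin 3) (Fin 3) ℤ) : Prop :=
  ∀ i i' j j', M i j * M i' j' = M i j' * M i' j

/-- A vector orthogonal to both `p` and `q` is parallel to their cross product. -/
theorem mul_cross_comm {p q n : Fin 3 → ℤ} (hp : p ⬝ᵥ n = 0) (hq : q ⬝ᵥ n = 0) (j k : Fin 3) :
    n j * (p ⨯₃ q) k = n k * (p ⨯₃ q) j := by
  simp only [dotProduct, Fin.sum_univ_three] at hp hq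
  have h01 : n 0 * (p ⨯₃ q) 1 = n 1 * (p ⨯₃ q) 0 := by
    simp [cross_apply]; linear_combination p 2 * hq - q 2 * hp
  have h12 : n 1 * (p ⨯₃ q) 2 = n 2 * (p ⨯₃ q) 1 := by
    simp [cross_apply]; linear_combination p 0 * hq - q 0 * hp
  have h20 : n 2 * (p ⨯₃ q) 0 = n 0 * (p ⨯₃ q) 2 := by
    simp [cross_apply]; linear_combination p 1 * hq - q 1 * hp
  fin_cases j <;> fin_cases k <;> first | rfl | assumption | (symm; assumption)

theorem mul_comm_of_cross_eq_zero {p q : Fin 3 → ℤ} (h : p ⨯₃ q = 0) (j k : Fin 3) :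
    p j * q k = p k * q j := by
  have h0 := congrFun h 0
  have h1 := congrFun h 1
  have h2 := congrFun h 2
  simp [cross_apply] at h0 h1 h2
  fin_cases j <;> fin_cases k <;> simp <;> linarith

theorem parallel_or_parallel {p q n m : Fin 3 → ℤ} (h1 : p ⬝ᵥ n = 0) (h2 : p ⬝ᵥ m = 0)
    (h3 : q ⬝ᵥ n = 0) (h4 : q ⬝ᵥ m = 0) :
    (∀ j k, p j * q k = p k * q j) ∨ (∀ j k, n j * m k = n k * m j) := by
  by_cases hw : p ⨯₃ q = 0
  · exact .inl (mul_comm_of_cross_eq_zero hw)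
  · obtain ⟨i, hi⟩ := Function.ne_iff.1 hw
    refine .inr fun j k => mul_right_cancel₀ (pow_ne_zero 2 hi) ?_
    have hn := fun j => mul_cross_comm h1 h3 j i
    have hm := fun j => mul_cross_comm h2 h4 j i
    linear_combination m k * (p ⨯₃ q) i * hn j + n i * (p ⨯₃ q) j * hm k -
      m j * (p ⨯₃ q) i * hn k - n i * (p ⨯₃ q) k * hm j

theorem minorsVanish_or_of_mul_eq_zero {M N : Matrix (Fin 3) (Fin 3) ℤ} (h : M * N = 0) :
    MinorsVanish M ∨ MinorsVanish N := by
  by_contra! hh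
  simp only [MinorsVanish, not_forall] at hh
  obtain ⟨⟨i, i', j, j', hM⟩, ⟨k, k', l, l', hN⟩⟩ := hh
  have e : ∀ a b, M a ⬝ᵥ (fun c => N c b) = 0 := fun a b => congrFun (congrFun h a) b
  rcases parallel_or_parallel (e i l) (e i l') (e i' l) (e i' l') with h | h
  · exact hM (h j j')
  · exact hN ((h k k').trans (mul_comm _ _))

theorem exists_sq_of_sq_eq_cube {D m : ℤ} (h : m ^ 2 = D ^ 3) : ∃ d : ℤ, D = d ^ 2 := by
  by_cases hD : D = 0
  · exact ⟨0, by simp [hD]⟩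
  have : D ∣ m := by
    rw [← Int.pow_dvd_pow_iff (two_ne_zero), h]; exact ⟨D, by ring⟩
  obtain ⟨e, rfl⟩ := this
  refine ⟨e, ?_⟩
  have : D ^ 2 * (D - e ^ 2) = 0 := by linear_combination -h
  rcases mul_eq_zero.1 this with h | h
  · exact absurd h (pow_ne_zero _ hD)
  · linarith

/-- An integer matrix whose `2 × 2` minors vanish is an outer product of integer vectors. -/
theorem MinorsVanish.exists_vecMulVec {M : Matrix (Fin 3) (Fin 3) ℤ} (h : MinorsVanish M) :
    ∃ x y : Fin 3 → ℤ, M = vecMulVec x y := by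
  by_cases h0 : M = 0
  · exact ⟨0, 0, by simp [h0]⟩
  obtain ⟨i, j, hij⟩ : ∃ i j, M i j ≠ 0 := by
    by_contra! hh; exact h0 (by ext; simp [hh])
  have hg : Finset.univ.gcd (M i) ≠ 0 := by
    rw [Ne, Finset.gcd_eq_zero_iff]; push Not; exact ⟨j, by simp, hij⟩
  obtain ⟨y, hy, hy1⟩ := Finset.extract_gcd (M i) (s := Finset.univ) ⟨0, by simp⟩
  obtain ⟨c, hc⟩ := Finset.gcd_eq_sum_mul Finset.univ y
  rw [hy1] at hc
  refine ⟨fun k => ∑ l, M k l * c l, y, ?_⟩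
  ext k l
  have hpar : ∀ l', M k l * y l' = M k l' * y l := fun l' => by
    have := h k i l l'
    rw [hy l (by simp), hy l' (by simp)] at this
    refine mul_left_cancel₀ hg ?_
    linear_combination this
  calc M k l = M k l * ∑ l', y l' * c l' := by rw [← hc, mul_one]
    _ = ∑ l', (M k l * y l') * c l' := by rw [Finset.mul_sum]; simp [mul_assoc]
    _ = (∑ l', M k l' * c l') * y l := by
      rw [Finset.sum_mul]; exact Finset.sum_congr rfl fun l' _ => by rw [hpar]; ring

theorem dvd_of_quadratic {k l b c : ℤ} (hk : k ≠ 0) (h : l ^ 2 + b * l * k + c * k ^ 2 = 0) :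
    k ∣ l := by
  have hk' : (k : ℚ) ≠ 0 := by exact_mod_cast hk
  have hq : (l : ℚ) ^ 2 + b * l * k + c * k ^ 2 = 0 := by exact_mod_cast h
  have hm : (X ^ 2 + C b * X + C c : ℤ[X]).Monic := by monicity!
  obtain ⟨m, hm⟩ := exists_integer_of_is_root_of_monic hm (K := ℚ) (r := (l / k : ℚ)) (by
    simp only [map_add, map_mul, map_pow, aeval_X, eq_intCast]
    simp
    field_simp
    linarith)
  refine ⟨m, ?_⟩
  have := hm.1
  simp at this
  rw [div_eq_iff hk'] at this
  have h2 : (l : ℤ) = m * k := by exact_mod_cast this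
  linarith

/-- The matrix with rows `v`, `A v`, `A² v`. -/
def krylov (A : Matrix (Fin 3) (Fin 3) ℤ) (v : Fin 3 → ℤ) : Matrix (Fin 3) (Fin 3) ℤ :=
  of ![v, A *ᵥ v, A *ᵥ (A *ᵥ v)]

/-- The matrix `A` has a rational cyclic vector. -/
def HasCyclicVector (A : Matrix (Fin 3) (Fin 3) ℤ) : Prop :=
  ∃ v, (krylov A v).det ≠ 0

theorem vecMul_krylov (A : Matrix (Fin 3) (Fin 3) ℤ) (v c : Fin 3 → ℤ) :
    c ᵥ* krylov A v = (c 0 • (1 : Matrix (Fin 3) (Fin 3) ℤ) + c 1 • A + c 2 • (A * A)) *ᵥ v := by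
  simp only [add_mulVec, smul_mulVec, one_mulVec, ← mulVec_mulVec]
  ext j
  simp [krylov, vecMul, dotProduct, Fin.sum_univ_three]

theorem exists_quadratic_of_not_hasCyclicVector {A : Matrix (Fin 3) (Fin 3) ℤ}
    (h : ¬ HasCyclicVector A) :
    ∃ c : Fin 3 → ℤ, c ≠ 0 ∧ c 0 • (1 : Matrix (Fin 3) (Fin 3) ℤ) + c 1 • A + c 2 • (A * A) = 0 := by
  simp only [HasCyclicVector, not_exists, not_not] at h
  set B : Matrix (Fin 3) (Fin 3) ℚ := A.map (Int.castRingHom ℚ) with hB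
  obtain ⟨x, hx⟩ := Module.exists_ker_toSpanSingleton_eq_annihilator ℚ[X]
    (Module.AEval ℚ (Fin 3 → ℚ) (toLin' B))
  obtain ⟨x, rfl⟩ := (Module.AEval.of ℚ (Fin 3 → ℚ) (toLin' B)).surjective x
  obtain ⟨d, hd⟩ := IsLocalization.exist_integer_multiples_of_finite (nonZeroDivisors ℤ) x
  choose v hv using hd
  have hd0 : ((d : ℤ) : ℚ) ≠ 0 := by exact_mod_cast nonZeroDivisors.coe_ne_zero d
  have hv' : (fun i => (v i : ℚ)) = ((d : ℤ) : ℚ) • x := by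
    ext i; simpa using hv i
  obtain ⟨c, hc0, hc⟩ := exists_vecMul_eq_zero_iff.2 (h v)
  refine ⟨c, hc0, ?_⟩
  rw [vecMul_krylov] at hc
  set P : Matrix (Fin 3) (Fin 3) ℤ := c 0 • 1 + c 1 • A + c 2 • (A * A) with hP
  set p : ℚ[X] := C (c 0 : ℚ) + C (c 1 : ℚ) * X + C (c 2 : ℚ) * (X * X) with hp
  have hPp : aeval (toLin' B) p = toLin' (P.map (Int.castRingHom ℚ)) := by
    have e : P.map (Int.castRingHom ℚ) = (c 0 : ℚ) • 1 + (c 1 : ℚ) • B + (c 2 : ℚ) • (B * B) := by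
      rw [hB, ← Matrix.map_mul]
      ext i j
      simp [hP, Matrix.one_apply, apply_ite, -zsmul_eq_mul, -zsmul_one]
    rw [e]
    simp only [hp, map_add, map_mul, aeval_C, aeval_X, map_smul, toLin'_mul, toLin'_one,
      Algebra.algebraMap_eq_smul_one, smul_mul_assoc, one_mul]
    rfl
  have hPx : (P.map (Int.castRingHom ℚ)) *ᵥ x = 0 := by
    have e : (P.map (Int.castRingHom ℚ)) *ᵥ (((d : ℤ) : ℚ) • x) = 0 := by
      rw [← hv']
      ext i
      have := congrArg (Int.cast : ℤ → ℚ) (congrFun hc i)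
      simpa [mulVec, dotProduct] using this
    rw [mulVec_smul] at e
    exact (smul_eq_zero.1 e).resolve_left hd0
  have hker : p ∈ Module.annihilator ℚ[X] (Module.AEval ℚ (Fin 3 → ℚ) (toLin' B)) := by
    rw [← hx, LinearMap.mem_ker, LinearMap.toSpanSingleton_apply, ← Module.AEval.of_aeval_smul, hPp]
    rw [Module.End.smul_def, toLin'_apply, hPx, map_zero]
  rw [Module.AEval.annihilator_eq_ker_aeval, RingHom.mem_ker] at hker
  have : P.map (Int.castRingHom ℚ) = 0 := by
    apply toLin'.injective; rw [← hPp, map_zero]; exact hker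
  ext i j
  have := congrFun (congrFun this i) j
  simpa using this

/-- A nonzero integer matrix with vanishing last entry and without cyclic vectors is an outer
product up to a scalar matrix. -/
theorem exists_eq_vecMulVec_sub {A : Matrix (Fin 3) (Fin 3) ℤ} (h : ¬ HasCyclicVector A)
    (h22 : A 2 2 = 0) (h0 : A ≠ 0) :
    ∃ x y : Fin 3 → ℤ, A = vecMulVec x y - (x 2 * y 2) • (1 : Matrix (Fin 3) (Fin 3) ℤ) := by
  obtain ⟨c, hc0, hc⟩ := exists_quadratic_of_not_hasCyclicVector h
  have hc2 : c 2 ≠ 0 := by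
    intro h2
    have e0 : c 0 = 0 := by simpa [h22, h2, -zsmul_eq_mul, -zsmul_one] using congrFun (congrFun hc 2) 2
    simp only [e0, h2, zero_smul, zero_add, add_zero, smul_eq_zero, h0, or_false] at hc
    apply hc0; ext i; fin_cases i <;> simpa
  set T : Matrix (Fin 3) (Fin 3) ℤ := (2 * c 2) • A + c 1 • 1 with hT
  set D := c 1 ^ 2 - 4 * c 0 * c 2 with hD
  have hTT : T * T = D • 1 := by
    have e : T * T = (4 * c 2) • (c 0 • 1 + c 1 • A + c 2 • (A * A)) + D • 1 := by
      simp only [hT, hD, add_mul, mul_add, smul_mul_assoc, mul_smul_comm, one_mul, mul_one]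
      module
    rw [e, hc, smul_zero, zero_add]
  obtain ⟨d, hd⟩ : ∃ d : ℤ, D = d ^ 2 := by
    apply exists_sq_of_sq_eq_cube (m := T.det)
    have := congrArg det hTT
    simpa [sq, -zsmul_eq_mul, -zsmul_one] using this
  have hfac : (T - d • 1) * (T + d • 1) = 0 := by
    simp only [sub_mul, mul_add, smul_mul_assoc, mul_smul_comm, one_mul, mul_one, hTT, hd]
    module
  have key : ∃ l : ℤ, MinorsVanish ((2 * c 2) • A + l • 1) := by
    rcases minorsVanish_or_of_mul_eq_zero hfac with h | h
    · exact ⟨c 1 - d, by convert h using 1; rw [hT]; module⟩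
    · exact ⟨c 1 + d, by convert h using 1; rw [hT]; module⟩
  obtain ⟨l, hl⟩ := key
  have hk : 2 * c 2 ≠ 0 := by simpa
  obtain ⟨m, rfl⟩ : 2 * c 2 ∣ l := by
    apply dvd_of_quadratic hk (b := A 0 0) (c := - (A 0 2 * A 2 0))
    have := hl 0 2 0 2
    simp [h22, -zsmul_eq_mul, -zsmul_one] at this
    linear_combination this
  have hm : MinorsVanish (A + m • 1) := by
    intro i i' j j'
    have := hl i i' j j'
    rw [mul_smul _ m, ← smul_add] at this
    simp only [Matrix.smul_apply _ (A + _), smul_eq_mul] at this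
    exact mul_left_cancel₀ (pow_ne_zero 2 hk) (by linear_combination this)
  obtain ⟨x, y, hxy⟩ := hm.exists_vecMulVec
  refine ⟨x, y, ?_⟩
  have e : m = x 2 * y 2 := by simpa [h22, vecMulVec_apply, -zsmul_eq_mul, -zsmul_one] using congrFun (congrFun hxy 2) 2
  rw [← hxy, e]; abel

/-- Integer matrices commuting with `A` and having last diagonal entry zero. -/
def normalizedCentralizer (A : Matrix (Fin 3) (Fin 3) ℤ) :
    Submodule ℤ (Matrix (Fin 3) (Fin 3) ℤ) where
  carrier := {B | A * B = B * A ∧ B 2 2 = 0}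
  add_mem' := by
    rintro B C ⟨hB, hB'⟩ ⟨hC, hC'⟩
    exact ⟨by rw [mul_add, add_mul, hB, hC], by simp [hB', hC']⟩
  zero_mem' := by simp
  smul_mem' := by
    rintro c B ⟨hB, hB'⟩
    exact ⟨by rw [mul_smul_comm, smul_mul_assoc, hB], by rw [Matrix.smul_apply, hB', smul_zero]⟩

theorem mem_normalizedCentralizer {A B : Matrix (Fin 3) (Fin 3) ℤ} :
    B ∈ normalizedCentralizer A ↔ A * B = B * A ∧ B 2 2 = 0 := Iff.rfl

theorem eq_zero_of_commute_of_mulVec_eq_zero {A B : Matrix (Fin 3) (Fin 3) ℤ} {v : Fin 3 → ℤ}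
    (hv : (krylov A v).det ≠ 0) (h : A * B = B * A) (hB : B *ᵥ v = 0) : B = 0 := by
  have h1 : B *ᵥ (A *ᵥ v) = 0 := by rw [mulVec_mulVec, ← h, ← mulVec_mulVec, hB, mulVec_zero]
  have h2 : B *ᵥ (A *ᵥ (A *ᵥ v)) = 0 := by
    rw [mulVec_mulVec, ← h, ← mulVec_mulVec, h1, mulVec_zero]
  have hK : krylov A v * Bᵀ = 0 := by
    ext i j
    have e : (krylov A v * Bᵀ) i j = (B *ᵥ (krylov A v i)) j := by
      simp [mul_apply, mulVec, dotProduct, mul_comm]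
    rw [e]
    fin_cases i
    · exact congrFun hB j
    · exact congrFun h1 j
    · exact congrFun h2 j
  have hd : (krylov A v).det • Bᵀ = 0 := by
    rw [← one_mul Bᵀ, ← smul_mul_assoc, ← adjugate_mul, mul_assoc, hK, mul_zero]
  exact transpose_eq_zero.1 ((smul_eq_zero.1 hd).resolve_left hv)

/-- The centralizer of a matrix with a cyclic vector is commutative. -/
theorem HasCyclicVector.mul_comm {A B C : Matrix (Fin 3) (Fin 3) ℤ} (h : HasCyclicVector A)
    (hB : A * B = B * A) (hC : A * C = C * A) : B * C = C * B := by
  obtain ⟨v, hv⟩ := h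
  set c := (B *ᵥ v) ᵥ* (krylov A v).adjugate
  set P : Matrix (Fin 3) (Fin 3) ℤ := c 0 • 1 + c 1 • A + c 2 • (A * A) with hP
  have hcomm : ∀ X : Matrix (Fin 3) (Fin 3) ℤ, A * X = X * A → P * X = X * P := by
    intro X hX
    have : A * A * X = X * (A * A) := by rw [mul_assoc, hX, ← mul_assoc, hX, mul_assoc]
    simp only [hP, add_mul, mul_add, smul_mul_assoc, mul_smul_comm, hX, this, one_mul, mul_one]
  have hBP : (krylov A v).det • B = P := by
    rw [← sub_eq_zero]
    refine eq_zero_of_commute_of_mulVec_eq_zero hv ?_ ?_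
    · rw [mul_sub, sub_mul, mul_smul_comm, smul_mul_assoc, hB, hcomm A rfl]
    · rw [sub_mulVec, ← vecMul_krylov, smul_mulVec, vecMul_vecMul, adjugate_mul, vecMul_smul,
        vecMul_one, sub_self]
  refine smul_right_injective _ hv ?_
  simp only
  rw [← smul_mul_assoc, ← mul_smul_comm, hBP, hcomm C hC]

theorem finrank_add_one_le_of_injective {L : Submodule ℤ (Matrix (Fin 3) (Fin 3) ℤ)}
    {ι : Type*} [Fintype ι] (f : Matrix (Fin 3) (Fin 3) ℤ →ₗ[ℤ] ι → ℤ)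
    (hL : ∀ B ∈ L, B 2 2 = 0) (hf : ∀ B ∈ L, ∀ k : ℤ, f (B + k • 1) = 0 → B + k • 1 = 0) :
    Module.finrank ℤ L + 1 ≤ Fintype.card ι := by
  let g : (L × ℤ) →ₗ[ℤ] ι → ℤ := f ∘ₗ (L.subtype.coprod (LinearMap.toSpanSingleton ℤ _ 1))
  have hg : Function.Injective g := by
    rw [← LinearMap.ker_eq_bot, LinearMap.ker_eq_bot']
    rintro ⟨⟨B, hB⟩, k⟩ h
    have h0 := hf B hB k (by simpa [g, -zsmul_eq_mul, -zsmul_one] using h)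
    have hk : k = 0 := by
      simpa [hL B hB, -zsmul_eq_mul, -zsmul_one] using congrFun (congrFun h0 2) 2
    subst hk
    simpa using h0
  have := LinearMap.finrank_le_finrank_of_injective hg
  rwa [Module.finrank_prod, Module.finrank_self, Module.finrank_fintype_fun_eq_card] at this

theorem HasCyclicVector.finrank_le {A : Matrix (Fin 3) (Fin 3) ℤ} (h : HasCyclicVector A) :
    Module.finrank ℤ (normalizedCentralizer A) ≤ 2 := by
  obtain ⟨v, hv⟩ := h
  have := finrank_add_one_le_of_injective (L := normalizedCentralizer A) (ι := Fin 3)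
    ((mulVecBilin ℤ ℤ).flip v) (fun B hB => hB.2) fun B hB k h0 =>
      eq_zero_of_commute_of_mulVec_eq_zero hv
        (by rw [mul_add, add_mul, hB.1, mul_smul_comm, smul_mul_assoc, mul_one, one_mul]) h0
  rw [Fintype.card_fin] at this
  omega

/-- The normalized centralizer of a matrix `x yᵀ - c` with `x, y ≠ 0` has rank at most `4`. -/
theorem finrank_le_of_eq_vecMulVec {A : Matrix (Fin 3) (Fin 3) ℤ} {x y : Fin 3 → ℤ} {c : ℤ}
    (hA : A = vecMulVec x y - c • (1 : Matrix (Fin 3) (Fin 3) ℤ)) (hx : x ≠ 0) (hy : y ≠ 0) :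
    Module.finrank ℤ (normalizedCentralizer A) ≤ 4 := by
  obtain ⟨i, hi⟩ := Function.ne_iff.1 hx
  obtain ⟨j, hj⟩ := Function.ne_iff.1 hy
  simp only [Pi.zero_apply] at hi hj
  let f : Matrix (Fin 3) (Fin 3) ℤ →ₗ[ℤ] (Option (Fin 2 × Fin 2) → ℤ) :=
    LinearMap.pi fun o => o.elim (LinearMap.proj i ∘ₗ (mulVecBilin ℤ ℤ).flip x)
      fun p => entryLinearMap ℤ ℤ (j.succAbove p.1) (i.succAbove p.2)
  have := finrank_add_one_le_of_injective (L := normalizedCentralizer A) f (fun B hB => hB.2) ?_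
  · simp only [Fintype.card_option, Fintype.card_prod, Fintype.card_fin] at this
    omega
  intro B hB k h0
  set C : Matrix (Fin 3) (Fin 3) ℤ := B + k • 1 with hC
  have hcomm : vecMulVec x y * C = C * vecMulVec x y := by
    have h1 : A * C = C * A := by
      rw [hC, mul_add, add_mul, hB.1, mul_smul_comm, smul_mul_assoc, mul_one, one_mul]
    rw [hA, sub_mul, mul_sub, smul_mul_assoc, mul_smul_comm, one_mul, mul_one] at h1
    exact sub_left_injective h1
  rw [vecMulVec_mul, mul_vecMulVec] at hcomm
  have hentry : ∀ a b, x a * (y ᵥ* C) b = (C *ᵥ x) a * y b := fun a b =>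
    congrFun (congrFun hcomm a) b
  have hi0 : (C *ᵥ x) i = 0 := congrFun h0 none
  have hyC : ∀ b, (y ᵥ* C) b = 0 := fun b => by
    have := hentry i b
    rw [hi0, zero_mul] at this
    exact (mul_eq_zero.1 this).resolve_left hi
  have hCx : ∀ a, (C *ᵥ x) a = 0 := fun a => by
    have := hentry a j
    rw [hyC, mul_zero] at this
    exact (mul_eq_zero.1 this.symm).resolve_right hj
  have hmin : ∀ a b, a ≠ j → b ≠ i → C a b = 0 := fun a b ha hb => by
    obtain ⟨a', rfl⟩ := Fin.exists_succAbove_eq ha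
    obtain ⟨b', rfl⟩ := Fin.exists_succAbove_eq hb
    exact congrFun h0 (some (a', b'))
  have hrow : ∀ a b, a ≠ j → C a b = 0 := fun a b ha => by
    by_cases hb : b = i
    · subst hb
      have := hCx a
      rw [mulVec, dotProduct, Finset.sum_eq_single b (fun b' _ hb' => by rw [hmin a b' ha hb', zero_mul])
        (by simp)] at this
      exact (mul_eq_zero.1 this).resolve_right hi
    · exact hmin a b ha hb
  ext a b
  by_cases ha : a = j
  · subst ha
    have := hyC b
    rw [vecMul, dotProduct, Finset.sum_eq_single a (fun a' _ ha' => by rw [hrow a' b ha', mul_zero])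
        (by simp)] at this
    exact (mul_eq_zero.1 this).resolve_left hj
  · exact hrow a b ha

/-- The largest absolute value of an entry of an integer vector. -/
def supHeight {ι : Type*} [Fintype ι] (v : ι → ℤ) : ℕ := Finset.univ.sup fun i => (v i).natAbs

theorem natAbs_le_supHeight {ι : Type*} [Fintype ι] (v : ι → ℤ) (i : ι) :
    (v i).natAbs ≤ supHeight v :=
  Finset.le_sup (f := fun i => (v i).natAbs) (Finset.mem_univ i)

theorem supHeight_le_iff {ι : Type*} [Fintype ι] {v : ι → ℤ} {n : ℕ} :
    supHeight v ≤ n ↔ ∀ i, (v i).natAbs ≤ n := by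
  simp [supHeight]

theorem exists_natAbs_eq_supHeight {ι : Type*} [Fintype ι] [Nonempty ι] (v : ι → ℤ) :
    ∃ i, (v i).natAbs = supHeight v := by
  obtain ⟨i, -, hi⟩ := Finset.exists_mem_eq_sup (Finset.univ : Finset ι) Finset.univ_nonempty
    (fun i => (v i).natAbs)
  exact ⟨i, hi.symm⟩

theorem supHeight_pos {ι : Type*} [Fintype ι] {v : ι → ℤ} (hv : v ≠ 0) : 0 < supHeight v := by
  obtain ⟨i, hi⟩ := Function.ne_iff.1 hv
  exact (Int.natAbs_pos.2 hi).trans_le (natAbs_le_supHeight v i)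

theorem card_supHeight_eq_le {ι : Type*} [Fintype ι] [Nonempty ι] {h : ℕ} (hh : 1 ≤ h)
    (S : Finset (ι → ℤ)) (hS : ∀ v ∈ S, supHeight v = h) :
    S.card ≤ Fintype.card ι * (2 * (3 * h) ^ (Fintype.card ι - 1)) := by
  classical
  let T : ι → Finset (ι → ℤ) := fun i => Fintype.piFinset
    (Function.update (fun _ => Finset.Icc (-(h : ℤ)) h) i {(h : ℤ), -(h : ℤ)})
  have hsub : S ⊆ Finset.univ.biUnion T := by
    intro v hv
    obtain ⟨i, hi⟩ := exists_natAbs_eq_supHeight v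
    rw [hS v hv] at hi
    simp only [Finset.mem_biUnion, Finset.mem_univ, true_and, T, Fintype.mem_piFinset]
    refine ⟨i, fun j => ?_⟩
    by_cases hj : j = i
    · subst hj
      simp only [Function.update_self, Finset.mem_insert, Finset.mem_singleton]
      omega
    · rw [Function.update_of_ne hj, Finset.mem_Icc]
      have := natAbs_le_supHeight v j
      rw [hS v hv] at this
      omega
  have hT : ∀ i, (T i).card ≤ 2 * (3 * h) ^ (Fintype.card ι - 1) := by
    intro i
    rw [Fintype.card_piFinset, ← Finset.mul_prod_erase _ _ (Finset.mem_univ i),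
      Function.update_self]
    refine Nat.mul_le_mul Finset.card_le_two ?_
    rw [← Finset.card_univ, ← Finset.card_erase_of_mem (Finset.mem_univ i)]
    refine Finset.prod_le_pow_card _ _ _ fun j hj => ?_
    rw [Function.update_of_ne (Finset.ne_of_mem_erase hj), Int.card_Icc]
    omega
  calc S.card ≤ (Finset.univ.biUnion T).card := Finset.card_le_card hsub
    _ ≤ ∑ i, (T i).card := Finset.card_biUnion_le
    _ ≤ ∑ _i : ι, 2 * (3 * h) ^ (Fintype.card ι - 1) := Finset.sum_le_sum fun i _ => hT i
    _ = _ := by simp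

theorem sum_inv_supHeight_pow_le {ι : Type*} [Fintype ι] [Nonempty ι] {k l N : ℕ}
    (hk : Fintype.card ι = k + l + 1) (S : Finset (ι → ℤ)) (h0 : ∀ v ∈ S, v ≠ 0)
    (hN : ∀ v ∈ S, supHeight v ≤ N) :
    ∑ v ∈ S, (1 / (supHeight v : ℝ)) ^ k ≤
      (k + l + 1) * (2 * 3 ^ (k + l)) * (N : ℝ) ^ (l + 1) := by
  classical
  have hmaps : ∀ v ∈ S, supHeight v ∈ Finset.Icc 1 N := fun v hv =>
    Finset.mem_Icc.2 ⟨supHeight_pos (h0 v hv), hN v hv⟩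
  rw [← Finset.sum_fiberwise_of_maps_to hmaps]
  have hfib : ∀ h ∈ Finset.Icc 1 N, ∑ v ∈ S with supHeight v = h, (1 / (supHeight v : ℝ)) ^ k ≤
      (k + l + 1) * (2 * 3 ^ (k + l)) * (N : ℝ) ^ l := by
    intro h hh
    obtain ⟨h1, h2⟩ := Finset.mem_Icc.1 hh
    have hc := card_supHeight_eq_le h1 (S.filter (supHeight · = h))
      (fun v hv => (Finset.mem_filter.1 hv).2)
    rw [hk, Nat.add_sub_cancel] at hc
    have hc' : ((S.filter (supHeight · = h)).card : ℝ) ≤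
        (k + l + 1) * (2 * (3 * h) ^ (k + l)) := by exact_mod_cast hc
    have hpos : (0 : ℝ) < h := by exact_mod_cast h1
    calc ∑ v ∈ S with supHeight v = h, (1 / (supHeight v : ℝ)) ^ k
        = (S.filter (supHeight · = h)).card * (1 / (h : ℝ)) ^ k := by
          rw [← nsmul_eq_mul]
          exact Finset.sum_eq_card_nsmul fun v hv => by rw [(Finset.mem_filter.1 hv).2]
      _ ≤ (k + l + 1) * (2 * (3 * h) ^ (k + l)) * (1 / (h : ℝ)) ^ k := by gcongr
      _ = (k + l + 1) * (2 * 3 ^ (k + l)) * (h : ℝ) ^ l := by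
          rw [mul_pow, pow_add (h : ℝ), one_div, inv_pow]; field_simp
      _ ≤ _ := by gcongr
  refine (Finset.sum_le_sum hfib).trans (le_of_eq ?_)
  rw [Finset.sum_const, Nat.card_Icc, nsmul_eq_mul, Nat.add_sub_cancel]
  ring

/-- The largest absolute value of an entry of an integer matrix. -/
def matHeight (A : Matrix (Fin 3) (Fin 3) ℤ) : ℕ := supHeight fun p : Fin 3 × Fin 3 => A p.1 p.2

theorem natAbs_le_matHeight (A : Matrix (Fin 3) (Fin 3) ℤ) (i j : Fin 3) :
    (A i j).natAbs ≤ matHeight A := natAbs_le_supHeight (fun p : Fin 3 × Fin 3 => A p.1 p.2) (i, j)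

theorem matHeight_le_iff {A : Matrix (Fin 3) (Fin 3) ℤ} {n : ℕ} :
    matHeight A ≤ n ↔ ∀ i j, (A i j).natAbs ≤ n := by
  simp [matHeight, supHeight_le_iff]

theorem matHeight_pos {A : Matrix (Fin 3) (Fin 3) ℤ} (hA : A ≠ 0) : 0 < matHeight A := by
  refine supHeight_pos fun h => hA ?_
  ext i j
  exact congrFun h (i, j)

theorem card_le_of_finrank_le {L : Submodule ℤ (Matrix (Fin 3) (Fin 3) ℤ)} {r h N : ℕ}
    (hr : Module.finrank ℤ L ≤ r) (h1 : 1 ≤ h) (hN : h ≤ N)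
    (hmin : ∀ B ∈ L, B ≠ 0 → h ≤ matHeight B) (S : Finset (Matrix (Fin 3) (Fin 3) ℤ))
    (hSL : ∀ B ∈ S, B ∈ L) (hSN : ∀ B ∈ S, matHeight B ≤ N) :
    (S.card : ℝ) ≤ (3 * N / h : ℝ) ^ r := by
  set m : ℕ := 2 * N / h + 1 with hm
  have hmh : 2 * N < m * h := by
    rw [hm, mul_comm (_ + 1)]; exact Nat.lt_mul_div_succ _ h1
  let b := Module.finBasis ℤ L
  let φ : S → (Fin (Module.finrank ℤ L) → ZMod m) := fun B i => (b.repr ⟨B, hSL B B.2⟩ i : ZMod m)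
  have hφ : Function.Injective φ := by
    intro B C hBC
    by_contra hne
    have hdvd : ∀ i, ∃ t : ℤ, b.repr ⟨B, hSL B B.2⟩ i - b.repr ⟨C, hSL C C.2⟩ i = m * t := by
      intro i
      have := congrFun hBC i
      obtain ⟨t, ht⟩ := (ZMod.intCast_eq_intCast_iff_dvd_sub _ _ _).1 this.symm
      exact ⟨t, ht⟩
    choose t ht using hdvd
    set l : L := ∑ i, t i • b i with hl
    have hsub : (⟨B, hSL B B.2⟩ - ⟨C, hSL C C.2⟩ : L) = (m : ℤ) • l := by
      apply b.repr.injective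
      ext i
      rw [map_sub, map_smul, hl, Finsupp.sub_apply, ht, Finsupp.smul_apply, b.repr_sum_self,
        smul_eq_mul]
    have hsub' : (B : Matrix (Fin 3) (Fin 3) ℤ) - C = (m : ℤ) • (l : Matrix (Fin 3) (Fin 3) ℤ) :=
      congrArg Subtype.val hsub
    have hl0 : (l : Matrix (Fin 3) (Fin 3) ℤ) ≠ 0 := by
      intro h0
      rw [h0, smul_zero, sub_eq_zero] at hsub'
      exact hne (Subtype.ext hsub')
    have hle := hmin l l.2 hl0
    have hlt : matHeight (l : Matrix (Fin 3) (Fin 3) ℤ) ≤ h - 1 := by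
      rw [matHeight_le_iff]
      intro i j
      have e := congrFun (congrFun hsub' i) j
      rw [Matrix.sub_apply, Matrix.smul_apply, smul_eq_mul] at e
      have e' := congrArg Int.natAbs e
      rw [Int.natAbs_mul, Int.natAbs_natCast] at e'
      have hb := (natAbs_le_matHeight B i j).trans (hSN B B.2)
      have hc := (natAbs_le_matHeight C i j).trans (hSN C C.2)
      have : m * ((l : Matrix (Fin 3) (Fin 3) ℤ) i j).natAbs < m * h := by omega
      have := Nat.lt_of_mul_lt_mul_left this
      omega
    omega
  have hcard : S.card ≤ m ^ r := by
    have := Fintype.card_le_of_injective φ hφ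
    rw [Fintype.card_coe, Fintype.card_fun, ZMod.card, Fintype.card_fin] at this
    exact this.trans (Nat.pow_le_pow_right (Nat.succ_pos _) hr)
  have hpos : (0 : ℝ) < h := by exact_mod_cast h1
  have hmle : (m : ℝ) ≤ 3 * N / h := by
    have h2 : ((2 * N / h : ℕ) : ℝ) ≤ 2 * N / h := by
      have := Nat.cast_div_le (α := ℝ) (m := 2 * N) (n := h)
      simpa using this
    have h3 : (1 : ℝ) ≤ N / h := by
      rw [le_div_iff₀ hpos, one_mul]; exact_mod_cast hN
    have h4 : (3 * N / h : ℝ) = 2 * N / h + N / h := by ring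
    rw [hm, h4]
    push_cast
    linarith
  calc (S.card : ℝ) ≤ (m : ℝ) ^ r := by exact_mod_cast hcard
    _ ≤ _ := by gcongr

theorem supHeight_mul_supHeight_le {A : Matrix (Fin 3) (Fin 3) ℤ} {x y : Fin 3 → ℤ}
    (hA : A = vecMulVec x y - (x 2 * y 2) • (1 : Matrix (Fin 3) (Fin 3) ℤ)) :
    supHeight x * supHeight y ≤ 3 * matHeight A := by
  have hent : ∀ a b, |A a b| ≤ (matHeight A : ℤ) := fun a b => by
    rw [Int.abs_eq_natAbs]
    exact_mod_cast natAbs_le_matHeight A a b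
  have hoff : ∀ a b, a ≠ b → |x a * y b| ≤ (matHeight A : ℤ) := fun a b hab => by
    have := hent a b
    rw [hA] at this
    rw [hA]
    simpa [vecMulVec_apply, hab, -zsmul_eq_mul, -zsmul_one] using this
  have hdiag : ∀ a, |x a * y a - x 2 * y 2| ≤ (matHeight A : ℤ) := fun a => by
    have := hent a a
    rw [hA] at this
    rw [hA]
    simpa [vecMulVec_apply, -zsmul_eq_mul, -zsmul_one] using this
  set h : ℤ := ((matHeight A : ℕ) : ℤ) with hh
  have hlast : |x 2 * y 2| ≤ 2 * h := by
    by_contra! hlt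
    have h1 := hdiag 0
    have h2 : |x 0 * y 0| > h := by
      have := abs_sub_abs_le_abs_sub (x 2 * y 2) (x 0 * y 0)
      rw [abs_sub_comm] at this
      linarith
    have h3 : |x 0 * y 0| * |x 2 * y 2| = |x 0 * y 2| * |x 2 * y 0| := by
      rw [← abs_mul, ← abs_mul]; congr 1; ring
    have h4 := hoff 0 2 (by decide)
    have h5 := hoff 2 0 (by decide)
    have hn : 0 ≤ h := by omega
    have h6 : |x 0 * y 2| * |x 2 * y 0| ≤ h * h := mul_le_mul h4 h5 (abs_nonneg _) hn
    nlinarith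
  obtain ⟨a, ha⟩ := exists_natAbs_eq_supHeight x
  obtain ⟨b, hb⟩ := exists_natAbs_eq_supHeight y
  have key : |x a * y b| ≤ 3 * h := by
    have hn : 0 ≤ h := by omega
    by_cases hab : a = b
    · subst hab
      have := abs_sub_abs_le_abs_sub (x a * y a) (x 2 * y 2)
      linarith [hdiag a]
    · linarith [hoff a b hab]
  rw [← ha, ← hb, ← Int.natAbs_mul]
  rw [Int.abs_eq_natAbs] at key
  omega

/-- Integer `3 × 3` matrices with entries bounded by `N`. -/
noncomputable def matBox (N : ℕ) : Finset (Matrix (Fin 3) (Fin 3) ℤ) :=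
  (Fintype.piFinset fun _ : Fin 3 => Fintype.piFinset fun _ : Fin 3 =>
    Finset.Icc (-(N : ℤ)) N).map Matrix.of.toEmbedding

theorem mem_matBox {N : ℕ} {A : Matrix (Fin 3) (Fin 3) ℤ} :
    A ∈ matBox N ↔ matHeight A ≤ N := by
  rw [matBox, Finset.mem_map_equiv, matHeight_le_iff, Fintype.mem_piFinset]
  refine forall_congr' fun i => ?_
  rw [Fintype.mem_piFinset]
  refine forall_congr' fun j => ?_
  rw [Finset.mem_Icc, Matrix.of_symm_apply]
  omega

theorem card_matBox (N : ℕ) : (matBox N).card = (2 * N + 1) ^ 9 := by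
  simp only [matBox, Finset.card_map, Fintype.card_piFinset, Int.card_Icc, Finset.prod_const,
    Finset.card_univ, Fintype.card_fin, ← pow_mul]
  congr 1
  omega

/-- Integer `3 × 3` matrices with entries bounded by `N` and last diagonal entry zero. -/
noncomputable def normBox (N : ℕ) : Finset (Matrix (Fin 3) (Fin 3) ℤ) :=
  (matBox N).filter fun A => A 2 2 = 0

theorem mem_normBox {N : ℕ} {A : Matrix (Fin 3) (Fin 3) ℤ} :
    A ∈ normBox N ↔ matHeight A ≤ N ∧ A 2 2 = 0 := by
  rw [normBox, Finset.mem_filter, mem_matBox]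

/-- Matrices in `normBox N` commuting with `A`. -/
noncomputable def commBox (N : ℕ) (A : Matrix (Fin 3) (Fin 3) ℤ) : Finset (Matrix (Fin 3) (Fin 3) ℤ) :=
  (normBox N).filter fun B => A * B = B * A

theorem mem_commBox {N : ℕ} {A B : Matrix (Fin 3) (Fin 3) ℤ} :
    B ∈ commBox N A ↔ B ∈ normalizedCentralizer A ∧ matHeight B ≤ N := by
  rw [commBox, Finset.mem_filter, mem_normBox, mem_normalizedCentralizer]
  tauto

theorem sum_inv_matHeight_pow_le {k l N : ℕ} (hk : 7 = k + l)
    (S : Finset (Matrix (Fin 3) (Fin 3) ℤ)) (h0 : ∀ A ∈ S, A ≠ 0) (hN : ∀ A ∈ S, A ∈ normBox N) :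
    ∑ A ∈ S, (1 / (matHeight A : ℝ)) ^ k ≤ 34992 * (N : ℝ) ^ (l + 1) := by
  classical
  let ι := {p : Fin 3 × Fin 3 // p ≠ (2, 2)}
  have hcard : Fintype.card ι = k + l + 1 := by
    rw [Fintype.card_subtype_compl, Fintype.card_subtype_eq, Fintype.card_prod, Fintype.card_fin]
    omega
  have : Nonempty ι := ⟨⟨(0, 0), by decide⟩⟩
  let ρ : Matrix (Fin 3) (Fin 3) ℤ → ι → ℤ := fun A p => A p.1.1 p.1.2
  have hρ : ∀ A : Matrix (Fin 3) (Fin 3) ℤ, A 2 2 = 0 → supHeight (ρ A) = matHeight A := by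
    intro A hA
    apply le_antisymm
    · exact supHeight_le_iff.2 fun p => natAbs_le_matHeight A _ _
    · refine matHeight_le_iff.2 fun i j => ?_
      by_cases hij : (i, j) = ((2, 2) : Fin 3 × Fin 3)
      · obtain ⟨rfl, rfl⟩ := Prod.mk.inj hij
        simp [hA]
      · exact natAbs_le_supHeight (ρ A) ⟨(i, j), hij⟩
  have hinj : Set.InjOn ρ S := by
    intro A hA B hB hAB
    ext i j
    by_cases hij : (i, j) = ((2, 2) : Fin 3 × Fin 3)
    · obtain ⟨rfl, rfl⟩ := Prod.mk.inj hij
      rw [(mem_normBox.1 (hN A hA)).2, (mem_normBox.1 (hN B hB)).2]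
    · exact congrFun hAB ⟨(i, j), hij⟩
  have hpos : ∀ A ∈ S, supHeight (ρ A) = matHeight A := fun A hA =>
    hρ A (mem_normBox.1 (hN A hA)).2
  have key := sum_inv_supHeight_pow_le (N := N) hcard (S.image ρ) ?_ ?_
  · rw [Finset.sum_image hinj] at key
    rw [Finset.sum_congr rfl fun A hA => by rw [hpos A hA]] at key
    refine key.trans (le_of_eq ?_)
    have : (k : ℝ) + l = 7 := by exact_mod_cast hk.symm
    rw [this, ← hk]
    norm_num
  · intro v hv h
    obtain ⟨A, hA, rfl⟩ := Finset.mem_image.1 hv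
    have := matHeight_pos (h0 A hA)
    rw [← hpos A hA, h] at this
    simp [supHeight] at this
  · intro v hv
    obtain ⟨A, hA, rfl⟩ := Finset.mem_image.1 hv
    rw [hpos A hA]
    exact (mem_normBox.1 (hN A hA)).1


theorem card_commBox_le_of_not_hasCyclicVector {A : Matrix (Fin 3) (Fin 3) ℤ} {N : ℕ} (hN : 0 < N)
    (h : ¬ HasCyclicVector A) (h22 : A 2 2 = 0) (h0 : A ≠ 0) :
    ((commBox N A).card : ℝ) ≤ (3 * N) ^ 4 := by
  obtain ⟨x, y, hxy⟩ := exists_eq_vecMulVec_sub h h22 h0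
  have hx : x ≠ 0 := by
    rintro rfl
    exact h0 (by rw [hxy]; simp)
  have hy : y ≠ 0 := by
    rintro rfl
    exact h0 (by rw [hxy]; simp)
  have := card_le_of_finrank_le (finrank_le_of_eq_vecMulVec hxy hx hy) le_rfl hN
    (fun B _ hB => matHeight_pos hB) (commBox N A) (fun B hB => (mem_commBox.1 hB).1)
    (fun B hB => (mem_commBox.1 hB).2)
  simpa using this

theorem exists_minimal_commuting : ∃ f : Matrix (Fin 3) (Fin 3) ℤ → Matrix (Fin 3) (Fin 3) ℤ,
    ∀ A, A ≠ 0 → A 2 2 = 0 → f A ≠ 0 ∧ f A ∈ normalizedCentralizer A ∧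
      matHeight (f A) ≤ matHeight A ∧
      (HasCyclicVector A → ∀ B ∈ normalizedCentralizer A, B ≠ 0 → matHeight (f A) ≤ matHeight B) ∧
      (¬ HasCyclicVector A → f A = A) := by
  have : ∀ A : Matrix (Fin 3) (Fin 3) ℤ, ∃ M : Matrix (Fin 3) (Fin 3) ℤ,
      A ≠ 0 → A 2 2 = 0 → M ≠ 0 ∧ M ∈ normalizedCentralizer A ∧ matHeight M ≤ matHeight A ∧
      (HasCyclicVector A → ∀ B ∈ normalizedCentralizer A, B ≠ 0 → matHeight M ≤ matHeight B) ∧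
      (¬ HasCyclicVector A → M = A) := by
    intro A
    by_cases hA : A ≠ 0 ∧ A 2 2 = 0
    swap
    · exact ⟨0, fun h1 h2 => absurd ⟨h1, h2⟩ hA⟩
    have hmem : A ∈ normalizedCentralizer A := ⟨rfl, hA.2⟩
    by_cases hc : HasCyclicVector A
    · obtain ⟨M, hM, hmin⟩ := (measure matHeight).wf.has_min
        {B | B ∈ normalizedCentralizer A ∧ B ≠ 0} ⟨A, hmem, hA.1⟩
      have hmin' : ∀ B ∈ normalizedCentralizer A, B ≠ 0 → matHeight M ≤ matHeight B :=
        fun B hB hB0 => not_lt.1 (hmin B ⟨hB, hB0⟩)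
      exact ⟨M, fun _ _ => ⟨hM.2, hM.1, hmin' A hmem hA.1, fun _ => hmin', fun h => absurd hc h⟩⟩
    · exact ⟨A, fun _ _ => ⟨hA.1, hmem, le_rfl, fun h => absurd h hc, fun _ => rfl⟩⟩
  choose f hf using this
  exact ⟨f, hf⟩

theorem sum_inv_matHeight_sq_le_of_not_hasCyclicVector {N : ℕ}
    (S : Finset (Matrix (Fin 3) (Fin 3) ℤ)) (h0 : ∀ A ∈ S, A ≠ 0) (hN : ∀ A ∈ S, A ∈ normBox N)
    (hc : ∀ A ∈ S, ¬ HasCyclicVector A) :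
    ∑ A ∈ S, (1 / (matHeight A : ℝ)) ^ 2 ≤ 2125764 * (N : ℝ) ^ 2 := by
  classical
  have : ∀ A : Matrix (Fin 3) (Fin 3) ℤ, ∃ x y : Fin 3 → ℤ, A ∈ S →
      A = vecMulVec x y - (x 2 * y 2) • (1 : Matrix (Fin 3) (Fin 3) ℤ) := by
    intro A
    by_cases hA : A ∈ S
    · obtain ⟨x, y, h⟩ := exists_eq_vecMulVec_sub (hc A hA) (mem_normBox.1 (hN A hA)).2 (h0 A hA)
      exact ⟨x, y, fun _ => h⟩
    · exact ⟨0, 0, fun h => absurd h hA⟩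
  choose x y hxy using this
  have hx : ∀ A ∈ S, x A ≠ 0 := fun A hA h => h0 A hA (by rw [hxy A hA, h]; simp)
  have hy : ∀ A ∈ S, y A ≠ 0 := fun A hA h => h0 A hA (by rw [hxy A hA, h]; simp)
  have hmul : ∀ A ∈ S, supHeight (x A) * supHeight (y A) ≤ 3 * matHeight A := fun A hA =>
    supHeight_mul_supHeight_le (hxy A hA)
  set T : Finset (Fin 3 → ℤ) :=
    (Fintype.piFinset fun _ => Finset.Icc (-((3 * N : ℕ) : ℤ)) (3 * N : ℕ)).filter (· ≠ 0) with hT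
  have hmemT : ∀ v : Fin 3 → ℤ, v ∈ T ↔ supHeight v ≤ 3 * N ∧ v ≠ 0 := by
    intro v
    rw [hT, Finset.mem_filter, Fintype.mem_piFinset, supHeight_le_iff]
    refine and_congr_left fun _ => forall_congr' fun i => ?_
    rw [Finset.mem_Icc]
    omega
  have hxT : ∀ A ∈ S, x A ∈ T := fun A hA => (hmemT _).2 ⟨by
    have h1 := hmul A hA
    have h2 := supHeight_pos (hy A hA)
    have h3 := (mem_normBox.1 (hN A hA)).1
    nlinarith [Nat.le_mul_of_pos_right (supHeight (x A)) h2], hx A hA⟩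
  have hyT : ∀ A ∈ S, y A ∈ T := fun A hA => (hmemT _).2 ⟨by
    have h1 := hmul A hA
    have h2 := supHeight_pos (hx A hA)
    have h3 := (mem_normBox.1 (hN A hA)).1
    nlinarith [Nat.le_mul_of_pos_left (supHeight (y A)) h2], hy A hA⟩
  have hinj : Set.InjOn (fun A => (x A, y A)) S := by
    intro A hA B hB hAB
    obtain ⟨h1, h2⟩ := Prod.mk.inj hAB
    rw [hxy A hA, hxy B hB, h1, h2]
  have hTsum := sum_inv_supHeight_pow_le (ι := Fin 3) (k := 2) (l := 0) (N := 3 * N) rfl T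
    (fun v hv => ((hmemT v).1 hv).2) (fun v hv => ((hmemT v).1 hv).1)
  have hTnn : 0 ≤ ∑ v ∈ T, (1 / (supHeight v : ℝ)) ^ 2 := Finset.sum_nonneg fun _ _ => by positivity
  let g : (Fin 3 → ℤ) × (Fin 3 → ℤ) → ℝ := fun p =>
    (1 / (supHeight p.1 : ℝ)) ^ 2 * (1 / (supHeight p.2 : ℝ)) ^ 2
  have hg : ∀ A ∈ S, (1 / (matHeight A : ℝ)) ^ 2 ≤ 9 * g (x A, y A) := by
    intro A hA
    have h1 : (0 : ℝ) < supHeight (x A) := by exact_mod_cast supHeight_pos (hx A hA)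
    have h2 : (0 : ℝ) < supHeight (y A) := by exact_mod_cast supHeight_pos (hy A hA)
    have h3 : (0 : ℝ) < matHeight A := by exact_mod_cast matHeight_pos (h0 A hA)
    have h4 : (supHeight (x A) : ℝ) * supHeight (y A) ≤ 3 * matHeight A := by
      exact_mod_cast hmul A hA
    have h5 : 1 / (matHeight A : ℝ) ≤ 3 / (supHeight (x A) * supHeight (y A)) := by
      rw [div_le_div_iff₀ h3 (mul_pos h1 h2)]
      linarith
    calc (1 / (matHeight A : ℝ)) ^ 2 ≤ (3 / (supHeight (x A) * supHeight (y A))) ^ 2 := by gcongr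
      _ = 9 * g (x A, y A) := by simp only [g]; field_simp; norm_num
  calc ∑ A ∈ S, (1 / (matHeight A : ℝ)) ^ 2 ≤ ∑ A ∈ S, 9 * g (x A, y A) := Finset.sum_le_sum hg
    _ = 9 * ∑ p ∈ S.image (fun A => (x A, y A)), g p := by
      rw [Finset.sum_image hinj, Finset.mul_sum]
    _ ≤ 9 * ∑ p ∈ T ×ˢ T, g p := by
      refine mul_le_mul_of_nonneg_left (Finset.sum_le_sum_of_subset_of_nonneg ?_ ?_) (by norm_num)
      · intro p hp
        obtain ⟨A, hA, rfl⟩ := Finset.mem_image.1 hp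
        exact Finset.mem_product.2 ⟨hxT A hA, hyT A hA⟩
      · intro p _ _
        positivity
    _ = 9 * ((∑ v ∈ T, (1 / (supHeight v : ℝ)) ^ 2) * ∑ v ∈ T, (1 / (supHeight v : ℝ)) ^ 2) := by
      rw [Finset.sum_mul_sum, Finset.sum_product]
    _ ≤ 9 * ((162 * N) * (162 * N)) := by
      have : ∑ v ∈ T, (1 / (supHeight v : ℝ)) ^ 2 ≤ (162 * N : ℝ) := by
        refine hTsum.trans (le_of_eq ?_)
        push_cast
        ring
      gcongr
    _ ≤ _ := by nlinarith [sq_nonneg (N : ℝ)]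

theorem sum_fiber_le {N : ℕ} (hN : 0 < N)
    {f : Matrix (Fin 3) (Fin 3) ℤ → Matrix (Fin 3) (Fin 3) ℤ}
    (hf : ∀ A, A ≠ 0 → A 2 2 = 0 → f A ≠ 0 ∧ f A ∈ normalizedCentralizer A ∧
      matHeight (f A) ≤ matHeight A ∧
      (HasCyclicVector A → ∀ B ∈ normalizedCentralizer A, B ≠ 0 → matHeight (f A) ≤ matHeight B) ∧
      (¬ HasCyclicVector A → f A = A)) {M : Matrix (Fin 3) (Fin 3) ℤ} (hM0 : M ≠ 0)
    (hM : M ∈ normBox N) (F : Finset (Matrix (Fin 3) (Fin 3) ℤ)) (hF0 : ∀ A ∈ F, A ≠ 0)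
    (hFN : ∀ A ∈ F, A ∈ normBox N) (hFM : ∀ A ∈ F, f A = M) :
    (HasCyclicVector M →
      ∑ A ∈ F, ((commBox N A).card : ℝ) ≤ 81 * N ^ 4 * (1 / (matHeight M : ℝ)) ^ 4) ∧
    (¬ HasCyclicVector M →
      ∑ A ∈ F, ((commBox N A).card : ℝ) ≤ 1458 * N ^ 6 * (1 / (matHeight M : ℝ)) ^ 2) := by
  classical
  obtain ⟨hMN, hM22⟩ := mem_normBox.1 hM
  have hM1 := matHeight_pos hM0
  have hpos : (0 : ℝ) < matHeight M := by exact_mod_cast hM1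
  have hle1 : (1 : ℝ) ≤ 3 * N / matHeight M := by
    rw [le_div_iff₀ hpos]
    have : (matHeight M : ℝ) ≤ N := by exact_mod_cast hMN
    linarith
  have hFsub : F ⊆ commBox N M := by
    intro A hA
    have h := mem_normBox.1 (hFN A hA)
    have h' := (hf A (hF0 A hA) h.2).2.1
    rw [hFM A hA] at h'
    exact mem_commBox.2 ⟨⟨h'.1.symm, h.2⟩, h.1⟩
  have hcyc : ∀ A ∈ F, HasCyclicVector A →
      ((commBox N A).card : ℝ) ≤ (3 * N / matHeight M) ^ 2 := by
    intro A hA hAc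
    have h := (hf A (hF0 A hA) (mem_normBox.1 (hFN A hA)).2).2.2.2.1 hAc
    rw [hFM A hA] at h
    exact card_le_of_finrank_le hAc.finrank_le hM1 hMN h _ (fun B hB => (mem_commBox.1 hB).1)
      (fun B hB => (mem_commBox.1 hB).2)
  have hnoncyc : ∀ A ∈ F, ¬ HasCyclicVector A → A = M := fun A hA hAc => by
    rw [← hFM A hA]
    exact ((hf A (hF0 A hA) (mem_normBox.1 (hFN A hA)).2).2.2.2.2 hAc).symm
  refine ⟨fun hMc => ?_, fun hMc => ?_⟩
  · have hFc : ∀ A ∈ F, HasCyclicVector A := fun A hA => by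
      by_contra hAc
      exact hAc (hnoncyc A hA hAc ▸ hMc)
    have hFcard : (F.card : ℝ) ≤ (3 * N / matHeight M) ^ 2 := by
      rcases F.eq_empty_or_nonempty with rfl | ⟨A, hA⟩
      · simp only [Finset.card_empty, Nat.cast_zero]
        positivity
      · refine card_le_of_finrank_le hMc.finrank_le hM1 hMN (fun B hB hB0 => ?_) F
          (fun B hB => (mem_commBox.1 (hFsub hB)).1) (fun B hB => (mem_commBox.1 (hFsub hB)).2)
        have h := (hf A (hF0 A hA) (mem_normBox.1 (hFN A hA)).2).2.2.2.1 (hFc A hA) B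
          ⟨hMc.mul_comm (mem_commBox.1 (hFsub hA)).1.1 hB.1, hB.2⟩ hB0
        rwa [hFM A hA] at h
    calc ∑ A ∈ F, ((commBox N A).card : ℝ) ≤ F.card • (3 * N / matHeight M : ℝ) ^ 2 :=
          Finset.sum_le_card_nsmul _ _ _ fun A hA => hcyc A hA (hFc A hA)
      _ ≤ (3 * N / matHeight M : ℝ) ^ 2 * (3 * N / matHeight M) ^ 2 := by
          rw [nsmul_eq_mul]
          gcongr
      _ = 81 * N ^ 4 * (1 / (matHeight M : ℝ)) ^ 4 := by field_simp; norm_num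
  · have hFcard : (F.card : ℝ) ≤ (3 * N) ^ 4 :=
      (Nat.cast_le.2 (Finset.card_le_card hFsub)).trans
        (card_commBox_le_of_not_hasCyclicVector hN hMc hM22 hM0)
    have hbound : ∀ A ∈ F, ((commBox N A).card : ℝ) ≤
        (3 * N / matHeight M) ^ 2 + if A = M then (3 * N : ℝ) ^ 4 else 0 := by
      intro A hA
      by_cases hAc : HasCyclicVector A
      · refine (hcyc A hA hAc).trans (le_add_of_nonneg_right ?_)
        split_ifs <;> positivity
      · rw [if_pos (hnoncyc A hA hAc), hnoncyc A hA hAc]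
        refine (card_commBox_le_of_not_hasCyclicVector hN hMc hM22 hM0).trans
          (le_add_of_nonneg_left (by positivity))
    have hite : ∑ A ∈ F, (if A = M then (3 * N : ℝ) ^ 4 else 0) ≤ (3 * N : ℝ) ^ 4 := by
      rw [Finset.sum_ite_eq']
      split_ifs
      · exact le_rfl
      · positivity
    calc ∑ A ∈ F, ((commBox N A).card : ℝ)
        ≤ F.card * (3 * N / matHeight M : ℝ) ^ 2 + (3 * N : ℝ) ^ 4 := by
          refine (Finset.sum_le_sum hbound).trans ?_
          rw [Finset.sum_add_distrib, Finset.sum_const, nsmul_eq_mul]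
          gcongr
      _ ≤ (3 * N : ℝ) ^ 4 * (3 * N / matHeight M : ℝ) ^ 2 +
            (3 * N : ℝ) ^ 4 * (3 * N / matHeight M : ℝ) ^ 2 := by
          gcongr
          exact le_mul_of_one_le_right (by positivity) (one_le_pow₀ hle1)
      _ = 1458 * N ^ 6 * (1 / (matHeight M : ℝ)) ^ 2 := by field_simp; norm_num

theorem exists_sum_card_commBox_le : ∃ C : ℝ, 0 < C ∧ ∀ N : ℕ, 0 < N →
    ∑ A ∈ normBox N, ((commBox N A).card : ℝ) ≤ C * (N : ℝ) ^ 8 := by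
  classical
  refine ⟨81 * 34992 + 1458 * 2125764 + 34993, by norm_num, fun N hN => ?_⟩
  obtain ⟨f, hf⟩ := exists_minimal_commuting
  have hN1 : (1 : ℝ) ≤ N := by exact_mod_cast hN
  set S := (normBox N).erase 0 with hS
  have hS0 : ∀ A ∈ S, A ≠ 0 := fun A hA => Finset.ne_of_mem_erase hA
  have hSN : ∀ A ∈ S, A ∈ normBox N := fun A hA => Finset.mem_of_mem_erase hA
  have hzero : (0 : Matrix (Fin 3) (Fin 3) ℤ) ∈ normBox N :=
    mem_normBox.2 ⟨matHeight_le_iff.2 (by simp), rfl⟩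
  have hScard : (S.card : ℝ) ≤ 34992 * (N : ℝ) ^ 8 := by
    simpa using sum_inv_matHeight_pow_le (k := 0) (l := 7) rfl S hS0 hSN
  have hbox : ((commBox N 0).card : ℝ) ≤ 34993 * (N : ℝ) ^ 8 := by
    have h1 : (commBox N 0).card ≤ S.card + 1 := by
      rw [hS, Finset.card_erase_add_one hzero]
      exact Finset.card_le_card (Finset.filter_subset _ _)
    have h2 : ((commBox N 0).card : ℝ) ≤ S.card + 1 := by exact_mod_cast h1
    have h3 : (1 : ℝ) ≤ (N : ℝ) ^ 8 := one_le_pow₀ hN1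
    linarith
  have hmaps : ∀ A ∈ S, f A ∈ S := fun A hA => by
    obtain ⟨h1, h2⟩ := mem_normBox.1 (hSN A hA)
    obtain ⟨g1, g2, g3, -⟩ := hf A (hS0 A hA) h2
    exact Finset.mem_erase.2 ⟨g1, mem_normBox.2 ⟨g3.trans h1, g2.2⟩⟩
  have hfib : ∀ M ∈ S, _ := fun M hM => sum_fiber_le hN hf (hS0 M hM) (hSN M hM)
    (S.filter (f · = M)) (fun A hA => hS0 A (Finset.mem_filter.1 hA).1)
    (fun A hA => hSN A (Finset.mem_filter.1 hA).1) (fun A hA => (Finset.mem_filter.1 hA).2)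
  rw [← Finset.add_sum_erase _ _ hzero, ← hS, ← Finset.sum_fiberwise_of_maps_to hmaps,
    ← Finset.sum_filter_add_sum_filter_not S HasCyclicVector]
  have h1 : ∑ M ∈ S with HasCyclicVector M, ∑ A ∈ S with f A = M, ((commBox N A).card : ℝ) ≤
      81 * 34992 * (N : ℝ) ^ 8 := by
    calc _ ≤ ∑ M ∈ S with HasCyclicVector M, 81 * (N : ℝ) ^ 4 * (1 / (matHeight M : ℝ)) ^ 4 :=
          Finset.sum_le_sum fun M hM =>
            (hfib M (Finset.mem_filter.1 hM).1).1 (Finset.mem_filter.1 hM).2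
      _ ≤ 81 * (N : ℝ) ^ 4 * (34992 * (N : ℝ) ^ (3 + 1)) := by
          rw [← Finset.mul_sum]
          refine mul_le_mul_of_nonneg_left (sum_inv_matHeight_pow_le rfl _
            (fun A hA => hS0 A (Finset.mem_filter.1 hA).1)
            (fun A hA => hSN A (Finset.mem_filter.1 hA).1)) (by positivity)
      _ = _ := by ring
  have h2 : ∑ M ∈ S with ¬ HasCyclicVector M, ∑ A ∈ S with f A = M, ((commBox N A).card : ℝ) ≤
      1458 * 2125764 * (N : ℝ) ^ 8 := by
    calc _ ≤ ∑ M ∈ S with ¬ HasCyclicVector M, 1458 * (N : ℝ) ^ 6 * (1 / (matHeight M : ℝ)) ^ 2 :=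
          Finset.sum_le_sum fun M hM =>
            (hfib M (Finset.mem_filter.1 hM).1).2 (Finset.mem_filter.1 hM).2
      _ ≤ 1458 * (N : ℝ) ^ 6 * (2125764 * (N : ℝ) ^ 2) := by
          rw [← Finset.mul_sum]
          refine mul_le_mul_of_nonneg_left (sum_inv_matHeight_sq_le_of_not_hasCyclicVector _
            (fun A hA => hS0 A (Finset.mem_filter.1 hA).1)
            (fun A hA => hSN A (Finset.mem_filter.1 hA).1)
            (fun A hA => (Finset.mem_filter.1 hA).2)) (by positivity)
      _ = _ := by ring
  linarith

theorem matCommCount_three_eq (N : ℕ) : matCommCount 3 N =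
    ((matBox N ×ˢ matBox N).filter fun p => p.1 * p.2 = p.2 * p.1).card := by
  refine Nat.subtype_card _ fun p => ?_
  rw [Finset.mem_filter, Finset.mem_product, mem_matBox, mem_matBox, matHeight_le_iff,
    matHeight_le_iff, and_assoc]
  simp only [Int.abs_eq_natAbs, Nat.cast_le]

theorem pow_ten_le_matCommCount (N : ℕ) : N ^ 10 ≤ matCommCount 3 N := by
  rw [matCommCount_three_eq]
  calc N ^ 10 ≤ (2 * N + 1) ^ 10 := by gcongr; omega
    _ = (matBox N ×ˢ Finset.Icc (-(N : ℤ)) N).card := by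
      rw [Finset.card_product, card_matBox, Int.card_Icc, pow_succ]
      congr 1
      omega
    _ ≤ _ := by
      refine Finset.card_le_card_of_injOn (fun p => (p.1, p.2 • (1 : Matrix (Fin 3) (Fin 3) ℤ)))
        ?_ ?_
      · rintro ⟨A, k⟩ h
        obtain ⟨hA, hk⟩ := Finset.mem_product.1 (Finset.mem_coe.1 h)
        rw [Finset.mem_Icc] at hk
        refine Finset.mem_coe.2 (Finset.mem_filter.2 ⟨Finset.mem_product.2 ⟨hA, ?_⟩, ?_⟩)
        · refine mem_matBox.2 (matHeight_le_iff.2 fun i j => ?_)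
          simp only [Matrix.smul_apply, one_apply, smul_eq_mul] at hk ⊢
          split_ifs <;> omega
        · simp only [mul_smul_comm, smul_mul_assoc, mul_one, one_mul]
      · rintro ⟨A, k⟩ - ⟨B, l⟩ - h
        obtain ⟨rfl, h2⟩ := Prod.mk.inj h
        have := congrFun (congrFun h2 0) 0
        simp only [Matrix.smul_apply, one_apply_eq, smul_eq_mul, mul_one] at this
        rw [this]

theorem sub_smul_one_mem_normBox {A : Matrix (Fin 3) (Fin 3) ℤ} {N : ℕ} (hA : A ∈ matBox N) :
    A - A 2 2 • (1 : Matrix (Fin 3) (Fin 3) ℤ) ∈ normBox (2 * N) := by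
  have h := matHeight_le_iff.1 (mem_matBox.1 hA)
  refine mem_normBox.2 ⟨matHeight_le_iff.2 fun i j => ?_, ?_⟩
  · rw [Matrix.sub_apply, Matrix.smul_apply, one_apply, smul_eq_mul]
    have h1 := h i j
    have h2 := h 2 2
    split_ifs <;> omega
  · rw [Matrix.sub_apply, Matrix.smul_apply, one_apply_eq, smul_eq_mul, mul_one, sub_self]

theorem matCommCount_three_le (N : ℕ) :
    matCommCount 3 N ≤ (∑ A ∈ normBox (2 * N), (commBox (2 * N) A).card) * (2 * N + 1) ^ 2 := by
  rw [matCommCount_three_eq]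
  calc _ ≤ ((normBox (2 * N)).sigma (commBox (2 * N)) ×ˢ
        (Finset.Icc (-(N : ℤ)) N ×ˢ Finset.Icc (-(N : ℤ)) N)).card := by
        refine Finset.card_le_card_of_injOn (fun p =>
          (⟨p.1 - p.1 2 2 • (1 : Matrix (Fin 3) (Fin 3) ℤ),
            p.2 - p.2 2 2 • (1 : Matrix (Fin 3) (Fin 3) ℤ)⟩, p.1 2 2, p.2 2 2)) ?_ ?_
        · rintro ⟨A, B⟩ h
          obtain ⟨h1, h2⟩ := Finset.mem_filter.1 (Finset.mem_coe.1 h)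
          obtain ⟨hA, hB⟩ := Finset.mem_product.1 h1
          simp only at hA hB h2
          have hA' := matHeight_le_iff.1 (mem_matBox.1 hA) 2 2
          have hB' := matHeight_le_iff.1 (mem_matBox.1 hB) 2 2
          refine Finset.mem_coe.2 (Finset.mem_product.2 ⟨Finset.mem_sigma.2
            ⟨sub_smul_one_mem_normBox hA, Finset.mem_filter.2 ⟨sub_smul_one_mem_normBox hB, ?_⟩⟩,
            Finset.mem_product.2 ⟨Finset.mem_Icc.2 ?_, Finset.mem_Icc.2 ?_⟩⟩)
          · simp only [sub_mul, mul_sub, smul_mul_assoc, mul_smul_comm, one_mul, mul_one, h2,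
              smul_sub, smul_comm (A 2 2) (B 2 2)]
            abel
          · simp only; omega
          · simp only; omega
        · rintro ⟨A, B⟩ - ⟨A', B'⟩ - h
          simp only [Prod.mk.injEq, Sigma.mk.injEq, heq_eq_eq] at h
          obtain ⟨⟨h1, h2⟩, h3, h4⟩ := h
          rw [h3] at h1
          rw [h4] at h2
          rw [sub_left_injective h1, sub_left_injective h2]
    _ = _ := by
      rw [Finset.card_product, Finset.card_product, Finset.card_sigma, Int.card_Icc, sq]
      congr 1
      congr 1 <;> omega

theorem commuting_3x3_count :
    ∃ c C : ℝ, 0 < c ∧ 0 < C ∧ ∀ N : ℕ, 0 < N →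
      c * (N : ℝ) ^ 10 ≤ (matCommCount 3 N : ℝ) ∧
      (matCommCount 3 N : ℝ) ≤ C * (N : ℝ) ^ 10 := by
  obtain ⟨C, hC, h⟩ := exists_sum_card_commBox_le
  refine ⟨1, C * 2 ^ 8 * 9, one_pos, by positivity, fun N hN => ⟨?_, ?_⟩⟩
  · rw [one_mul]
    exact_mod_cast pow_ten_le_matCommCount N
  · have hN1 : (1 : ℝ) ≤ N := by exact_mod_cast hN
    have h1 := h (2 * N) (by omega)
    push_cast at h1
    calc (matCommCount 3 N : ℝ)
        ≤ (∑ A ∈ normBox (2 * N), ((commBox (2 * N) A).card : ℝ)) * (2 * N + 1) ^ 2 := by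
          exact_mod_cast matCommCount_three_le N
      _ ≤ C * (2 * N) ^ 8 * (3 * N) ^ 2 := by
          gcongr
          linarith
      _ = _ := by ring
end

section
/- For every integer N > 1, one has 𝔠₂(N) = K·(2N)^5 + O(N^4 log N), where K = 10ζ(2)/(3ζ(3)) and ζ denotes the Riemann zeta function, with an absolute implied constant. -/
/-- The Riemann zeta function at a positive integer `s`, as the real series
`∑_{n ≥ 1} n^{-s}`. -/
noncomputable def zetaNat (s : ℕ) : ℝ := ∑' n : ℕ, 1 / ((n : ℝ) + 1) ^ s

namespace CommutingMatrices

open Finset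

lemma sum_eq_sum_comp {α β : Type*} {S : Finset α} {T : Finset β} (F : α → ℤ) (e : β → α)
    (he : Set.InjOn e T) (hS : ∀ v ∈ S, F v ≠ 0 → ∃ p ∈ T, e p = v)
    (hT : ∀ p ∈ T, F (e p) ≠ 0 → e p ∈ S) : ∑ v ∈ S, F v = ∑ p ∈ T, F (e p) := by
  symm
  refine Finset.sum_bij_ne_zero (fun p _ _ => e p) hT (fun a ha _ b hb _ h => he ha hb h) ?_
    (fun _ _ _ => rfl)
  intro v hv h
  obtain ⟨p, hp, rfl⟩ := hS v hv h
  exact ⟨p, hp, h, rfl⟩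

lemma sum_Icc_neg_of_even (f : ℤ → ℤ) (hf : ∀ u, f (-u) = f u) (r : ℕ) :
    ∑ u ∈ Icc (-(r : ℤ)) r, f u = f 0 + 2 * ∑ k ∈ Icc 1 r, f (k : ℕ) := by
  induction r with
  | zero => simp
  | succ r ih =>
    have : Icc (-((r + 1 : ℕ) : ℤ)) ((r + 1 : ℕ) : ℤ) =
        insert (-((r + 1 : ℕ) : ℤ)) (insert ((r + 1 : ℕ) : ℤ) (Icc (-(r : ℤ)) r)) := by
      ext x; simp only [mem_Icc, mem_insert]; omega
    rw [this, sum_insert (by simp; omega), sum_insert (by simp), ih, hf,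
      Finset.sum_Icc_succ_top (by omega)]
    ring

lemma sum_max_min (f : ℕ → ℕ → ℝ) (M : ℕ) :
    ∑ g ∈ Icc 1 M, ∑ k ∈ Icc 1 M, f (max g k) (min g k) =
      ∑ m ∈ Icc 1 M, (f m m + 2 * ∑ n ∈ Ico 1 m, f m n) := by
  induction M with
  | zero => simp
  | succ M ih =>
    have h1 : ∀ g ∈ Icc 1 M, f (max g (M + 1)) (min g (M + 1)) = f (M + 1) g := by
      intro g hg
      rw [mem_Icc] at hg
      rw [max_eq_right (by omega), min_eq_left (by omega)]
    have h2 : ∀ g ∈ Icc 1 M, f (max (M + 1) g) (min (M + 1) g) = f (M + 1) g := by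
      intro g hg
      rw [max_comm, min_comm, h1 g hg]
    simp only [Finset.sum_Icc_succ_top (Nat.le_add_left 1 M), sum_add_distrib, ih]
    rw [sum_congr rfl h1, sum_congr rfl h2]
    have h3 : Ico 1 (M + 1) = Icc 1 M := by ext; simp only [mem_Icc, mem_Ico]; omega
    rw [h3]
    simp
    ring

lemma abs_sum_Icc_sub_le {f : ℕ → ℝ} {s c : ℝ} (hf : HasSum (fun n => f (n + 1)) s)
    (hc : ∀ n, 1 ≤ n → |f n| ≤ c / (n : ℝ) ^ 2) {M : ℕ} (hM : 1 ≤ M) :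
    |∑ n ∈ Icc 1 M, f n - s| ≤ c / M := by
  have hc0 : 0 ≤ c := by
    have := (abs_nonneg _).trans (hc 1 le_rfl)
    simpa using this
  have hlim : Filter.Tendsto (fun K => |∑ n ∈ Icc 1 M, f n - ∑ i ∈ range K, f (i + 1)|)
      Filter.atTop (nhds |∑ n ∈ Icc 1 M, f n - s|) :=
    (tendsto_const_nhds.sub hf.tendsto_sum_nat).abs
  refine le_of_tendsto hlim ?_
  filter_upwards [Filter.eventually_ge_atTop M] with K hK
  have h1 : ∑ i ∈ range K, f (i + 1) = ∑ n ∈ Ico 1 (K + 1), f n := by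
    rw [Finset.sum_Ico_eq_sum_range]; simp [add_comm]
  have h2 : Icc 1 M = Ico 1 (M + 1) := by ext; simp only [mem_Icc, mem_Ico]; omega
  have h3 : Ico (M + 1) (K + 1) = Ioc M K := by ext; simp only [mem_Ico, mem_Ioc]; omega
  rw [h1, h2, ← Finset.sum_Ico_consecutive f (by omega : 1 ≤ M + 1) (by omega : M + 1 ≤ K + 1), h3]
  rw [sub_add_cancel_left, abs_neg]
  calc |∑ n ∈ Ioc M K, f n| ≤ ∑ n ∈ Ioc M K, |f n| := abs_sum_le_sum_abs _ _
    _ ≤ ∑ n ∈ Ioc M K, c * ((n : ℝ) ^ 2)⁻¹ := sum_le_sum fun n hn => by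
        rw [mem_Ioc] at hn
        simpa [div_eq_mul_inv] using hc n (by omega)
    _ = c * ∑ n ∈ Ioc M K, ((n : ℝ) ^ 2)⁻¹ := by rw [mul_sum]
    _ ≤ c * ((M : ℝ)⁻¹ - (K : ℝ)⁻¹) := by
        gcongr; exact sum_Ioc_inv_sq_le_sub (by omega) hK
    _ ≤ c / M := by
        rw [div_eq_mul_inv]; gcongr; simp

open scoped ArithmeticFunction.Moebius

/-- The integer vector `v` is parallel to `w`. -/
def Parallel (v w : ℤ × ℤ × ℤ) : Prop :=
  v.1 * w.2.1 = v.2.1 * w.1 ∧ v.1 * w.2.2 = v.2.2 * w.1 ∧ v.2.1 * w.2.2 = v.2.2 * w.2.1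

instance (v w : ℤ × ℤ × ℤ) : Decidable (Parallel v w) := by
  unfold Parallel; infer_instance

/-- The greatest common divisor of the coordinates of `v`. -/
def content (v : ℤ × ℤ × ℤ) : ℕ := Int.gcd v.1 (Int.gcd v.2.1 v.2.2)

lemma content_smul (g : ℕ) (p : ℤ × ℤ × ℤ) : content ((g : ℤ) • p) = g * content p := by
  simp only [content, Prod.smul_fst, Prod.smul_snd, smul_eq_mul, Int.gcd_mul_left, Int.natAbs_natCast]
  push_cast
  rw [Int.gcd_mul_left, Int.natAbs_natCast]

lemma content_eq_zero {v : ℤ × ℤ × ℤ} : content v = 0 ↔ v = 0 := by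
  obtain ⟨x, y, z⟩ := v
  simp [content, Int.gcd_eq_zero_iff, Prod.ext_iff]

lemma exists_eq_smul_of_dvd_content {d : ℕ} {v : ℤ × ℤ × ℤ} (h : d ∣ content v) :
    ∃ p, v = (d : ℤ) • p := by
  obtain ⟨x, y, z⟩ := v
  have h' : (d : ℤ) ∣ (content (x, y, z) : ℤ) := by exact_mod_cast h
  obtain ⟨a, ha⟩ := h'.trans (Int.gcd_dvd_left _ _)
  have h2 := h'.trans (Int.gcd_dvd_right _ _)
  obtain ⟨b, hb⟩ := h2.trans (Int.gcd_dvd_left _ _)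
  obtain ⟨c, hc⟩ := h2.trans (Int.gcd_dvd_right _ _)
  exact ⟨(a, b, c), by ext <;> simpa⟩

lemma smul_injective_of_ne_zero {k : ℤ} (hk : k ≠ 0) :
    Function.Injective fun p : ℤ × ℤ × ℤ => k • p := by
  rintro ⟨a, b, c⟩ ⟨a', b', c'⟩ h
  simpa [hk] using h

lemma smul_left_injective_of_content {p : ℤ × ℤ × ℤ} (hp : content p = 1) :
    Function.Injective fun k : ℤ => k • p := by
  intro a b h
  have h0 : p ≠ 0 := by rintro rfl; simp [content] at hp
  obtain ⟨x, y, z⟩ := p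
  simp only [Prod.smul_mk, smul_eq_mul, Prod.mk.injEq, mul_eq_mul_right_iff] at h
  simp only [ne_eq, Prod.mk_eq_zero] at h0
  tauto

lemma Parallel.exists_eq_smul {p w : ℤ × ℤ × ℤ} (hp : content p = 1) (h : Parallel p w) :
    ∃ k : ℤ, k • p = w := by
  obtain ⟨x, y, z⟩ := p
  obtain ⟨a, b, c⟩ := w
  obtain ⟨h1, h2, h3⟩ := h
  simp only at h1 h2 h3
  have e1 := Int.gcd_eq_gcd_ab x (Int.gcd y z)
  have e2 := Int.gcd_eq_gcd_ab y z
  have e3 : (Int.gcd x (Int.gcd y z) : ℤ) = 1 := by exact_mod_cast hp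
  rw [e3, e2] at e1
  generalize x.gcdA _ = α at e1
  generalize x.gcdB _ = β at e1
  generalize y.gcdA _ = γ at e1
  generalize y.gcdB _ = δ at e1
  refine ⟨α * a + β * γ * b + β * δ * c, ?_⟩
  simp only [Prod.smul_mk, smul_eq_mul, Prod.mk.injEq]
  refine ⟨?_, ?_, ?_⟩
  · linear_combination -a * e1 + β * γ * h1 + β * δ * h2
  · linear_combination -b * e1 - α * h1 + β * δ * h3
  · linear_combination -c * e1 - α * h2 - β * γ * h3

lemma parallel_smul (p : ℤ × ℤ × ℤ) (k : ℤ) : Parallel p (k • p) := by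
  simp only [Parallel, Prod.smul_fst, Prod.smul_snd, smul_eq_mul]
  refine ⟨?_, ?_, ?_⟩ <;> ring

lemma parallel_smul_left {g : ℤ} (hg : g ≠ 0) (p w : ℤ × ℤ × ℤ) :
    Parallel (g • p) w ↔ Parallel p w := by
  simp only [Parallel, Prod.smul_fst, Prod.smul_snd, smul_eq_mul, mul_assoc,
    mul_right_inj' hg]

/-- The indicator function of the interval `[-N, N]`. -/
noncomputable def boxWt (N : ℕ) (x : ℤ) : ℤ := if |x| ≤ N then 1 else 0

/-- The number of ways to write `u` as a difference of two integers of `[-N, N]`. -/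
noncomputable def tent (N : ℕ) (u : ℤ) : ℤ := max 0 (2 * N + 1 - |u|)

/-- The number of matrices with entries in `[-N, N]`, off-diagonal entries `v.1`, `v.2.1`, and
difference of the diagonal entries equal to `v.2.2`. -/
noncomputable def wt (N : ℕ) (v : ℤ × ℤ × ℤ) : ℤ := boxWt N v.1 * (boxWt N v.2.1 * tent N v.2.2)

/-- The cube `[-2N, 2N]³`. -/
noncomputable def cube (N : ℕ) : Finset (ℤ × ℤ × ℤ) :=
  Icc (-((2 * N : ℕ) : ℤ)) ((2 * N : ℕ) : ℤ) ×ˢ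
    (Icc (-((2 * N : ℕ) : ℤ)) ((2 * N : ℕ) : ℤ) ×ˢ Icc (-((2 * N : ℕ) : ℤ)) ((2 * N : ℕ) : ℤ))

lemma mem_cube {N : ℕ} {v : ℤ × ℤ × ℤ} :
    v ∈ cube N ↔ |v.1| ≤ 2 * N ∧ |v.2.1| ≤ 2 * N ∧ |v.2.2| ≤ 2 * N := by
  simp [cube, abs_le]

lemma mem_cube_of_wt_ne_zero {N : ℕ} {v : ℤ × ℤ × ℤ} (h : wt N v ≠ 0) : v ∈ cube N := by
  rw [mem_cube]
  simp only [wt, boxWt, tent, ne_eq, mul_eq_zero, not_or, ite_eq_right_iff, Classical.not_imp] at h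
  obtain ⟨⟨h1, -⟩, ⟨h2, -⟩, h3⟩ := h
  have : 0 < 2 * (N : ℤ) + 1 - |v.2.2| := by
    by_contra hc
    exact h3 (max_eq_left (by omega))
  omega

lemma wt_neg (N : ℕ) (v : ℤ × ℤ × ℤ) : wt N (-v) = wt N v := by
  simp [wt, boxWt, tent]

lemma wt_zero (N : ℕ) : wt N 0 = 2 * N + 1 := by
  simp [wt, boxWt, tent]; omega

lemma mem_cube_of_smul_mem {N : ℕ} {k : ℤ} (hk : k ≠ 0) {p : ℤ × ℤ × ℤ} (h : k • p ∈ cube N) :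
    p ∈ cube N := by
  rw [mem_cube] at h ⊢
  simp only [Prod.smul_fst, Prod.smul_snd, smul_eq_mul, abs_mul] at h
  have hk' : 1 ≤ |k| := Int.one_le_abs hk
  obtain ⟨h1, h2, h3⟩ := h
  exact ⟨(le_mul_of_one_le_left (abs_nonneg _) hk').trans h1,
    (le_mul_of_one_le_left (abs_nonneg _) hk').trans h2,
    (le_mul_of_one_le_left (abs_nonneg _) hk').trans h3⟩

lemma abs_le_of_smul_mem_cube {N : ℕ} {k : ℤ} {p : ℤ × ℤ × ℤ} (hp : p ≠ 0)
    (h : k • p ∈ cube N) : |k| ≤ 2 * N := by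
  rw [mem_cube] at h
  simp only [Prod.smul_fst, Prod.smul_snd, smul_eq_mul, abs_mul] at h
  obtain ⟨h1, h2, h3⟩ := h
  have key : ∀ x : ℤ, x ≠ 0 → |k| * |x| ≤ 2 * N → |k| ≤ 2 * N := fun x hx hh =>
    (le_mul_of_one_le_right (abs_nonneg _) (Int.one_le_abs hx)).trans hh
  by_cases hx : p.1 = 0
  · by_cases hy : p.2.1 = 0
    · have hz : p.2.2 ≠ 0 := fun hz => hp (by ext <;> simpa)
      exact key _ hz h3
    · exact key _ hy h2
  · exact key _ hx h1

lemma content_mem_Icc {N : ℕ} {v : ℤ × ℤ × ℤ} (hv : v ≠ 0) (h : v ∈ cube N) :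
    content v ∈ Icc 1 (2 * N) := by
  have h0 : content v ≠ 0 := fun h => hv (content_eq_zero.1 h)
  obtain ⟨p, hp⟩ := exists_eq_smul_of_dvd_content (dvd_refl (content v))
  have hp0 : p ≠ 0 := by rintro rfl; exact hv (by rw [hp, smul_zero])
  have := abs_le_of_smul_mem_cube hp0 (hp ▸ h)
  rw [Nat.abs_cast] at this
  rw [mem_Icc]; omega

/-- The primitive vectors of the cube `[-2N, 2N]³`. -/
noncomputable def primCube (N : ℕ) : Finset (ℤ × ℤ × ℤ) := (cube N).filter fun p => content p = 1

lemma sum_erase_zero_eq_sum_primCube {N : ℕ} (F : ℤ × ℤ × ℤ → ℤ)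
    (hF : ∀ v, F v ≠ 0 → v ∈ cube N) :
    ∑ v ∈ (cube N).erase 0, F v =
      ∑ g ∈ Icc 1 (2 * N), ∑ p ∈ primCube N, F (((g : ℕ) : ℤ) • p) := by
  rw [← Finset.sum_fiberwise_of_maps_to (t := Icc 1 (2 * N)) (g := content)
    (fun v hv => content_mem_Icc (mem_erase.1 hv).1 (mem_erase.1 hv).2)]
  refine sum_congr rfl fun g hg => ?_
  rw [mem_Icc] at hg
  have hg0 : (g : ℤ) ≠ 0 := by omega
  refine sum_eq_sum_comp F _ (smul_injective_of_ne_zero hg0).injOn ?_ ?_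
  · intro v hv _
    rw [mem_filter, mem_erase] at hv
    obtain ⟨p, rfl⟩ := exists_eq_smul_of_dvd_content hv.2.symm.dvd
    refine ⟨p, ?_, rfl⟩
    have := hv.2
    rw [content_smul] at this
    exact mem_filter.2 ⟨mem_cube_of_smul_mem hg0 hv.1.2,
      Nat.eq_of_mul_eq_mul_left (by omega) (this.trans (mul_one g).symm)⟩
  · intro p hp h
    have hp1 := (mem_filter.1 hp).2
    have hc : content ((g : ℤ) • p) = g := by rw [content_smul, hp1, mul_one]
    refine mem_filter.2 ⟨mem_erase.2 ⟨fun h0 => ?_, hF _ h⟩, hc⟩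
    rw [content_eq_zero.2 h0] at hc
    omega

lemma sum_primCube_eq_sum_moebius {N : ℕ} (F : ℤ × ℤ × ℤ → ℤ)
    (hF : ∀ v, F v ≠ 0 → v ∈ cube N) :
    ∑ p ∈ primCube N, F p =
      ∑ d ∈ Icc 1 (2 * N), μ d * ∑ q ∈ (cube N).erase 0, F (((d : ℕ) : ℤ) • q) := by
  have h1 : ∑ p ∈ primCube N, F p =
      ∑ v ∈ (cube N).erase 0, ∑ d ∈ Icc 1 (2 * N), if d ∣ content v then μ d * F v else 0 := by
    have hs : primCube N = ((cube N).erase 0).filter fun p => content p = 1 := by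
      ext p
      simp only [primCube, mem_filter, mem_erase]
      refine ⟨fun h => ⟨⟨fun h0 => ?_, h.1⟩, h.2⟩, fun h => ⟨h.1.2, h.2⟩⟩
      rw [content_eq_zero.2 h0] at h
      omega
    rw [hs, sum_filter]
    refine sum_congr rfl fun v hv => ?_
    have hc := content_mem_Icc (mem_erase.1 hv).1 (mem_erase.1 hv).2
    rw [mem_Icc] at hc
    rw [← sum_filter, ← sum_mul]
    have hd : (Icc 1 (2 * N)).filter (· ∣ content v) = (content v).divisors := by
      ext d
      simp only [mem_filter, mem_Icc, Nat.mem_divisors]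
      refine ⟨fun h => ⟨h.2, by omega⟩, fun h => ⟨⟨Nat.pos_of_dvd_of_pos h.1 (by omega), ?_⟩, h.1⟩⟩
      exact (Nat.le_of_dvd (by omega) h.1).trans hc.2
    rw [hd, ← ArithmeticFunction.coe_zeta_mul_apply, ArithmeticFunction.coe_zeta_mul_moebius,
      ArithmeticFunction.one_apply]
    split_ifs <;> simp
  rw [h1, sum_comm]
  refine sum_congr rfl fun d hd => ?_
  rw [mem_Icc] at hd
  have hd0 : (d : ℤ) ≠ 0 := by omega
  rw [← sum_filter, mul_sum]
  refine sum_eq_sum_comp (fun v => μ d * F v) _ (smul_injective_of_ne_zero hd0).injOn ?_ ?_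
  · intro v hv _
    rw [mem_filter, mem_erase] at hv
    obtain ⟨p, rfl⟩ := exists_eq_smul_of_dvd_content hv.2
    refine ⟨p, mem_erase.2 ⟨?_, mem_cube_of_smul_mem hd0 hv.1.2⟩, rfl⟩
    rintro rfl
    exact hv.1.1 (smul_zero _)
  · intro p hp h
    refine mem_filter.2 ⟨mem_erase.2 ⟨fun h0 => ?_, hF _ (right_ne_zero_of_mul h)⟩, ?_⟩
    · exact (mem_erase.1 hp).1 (smul_injective_of_ne_zero hd0 (by simpa using h0))
    · rw [content_smul]; exact dvd_mul_right _ _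

lemma sum_parallel_primitive {N : ℕ} {p : ℤ × ℤ × ℤ} (hp : content p = 1) :
    ∑ w ∈ cube N, (if Parallel p w then wt N w else 0) =
      (2 * N + 1) + 2 * ∑ k ∈ Icc 1 (2 * N), wt N (((k : ℕ) : ℤ) • p) := by
  have h0 : p ≠ 0 := by rintro rfl; simp [content] at hp
  rw [← wt_zero, ← zero_smul ℤ p, ← sum_Icc_neg_of_even (fun k => wt N (k • p))
    (fun k => by rw [neg_smul, wt_neg]), ← sum_filter]
  refine sum_eq_sum_comp _ _ (smul_left_injective_of_content hp).injOn ?_ ?_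
  · intro w hw _
    rw [mem_filter] at hw
    obtain ⟨k, rfl⟩ := hw.2.exists_eq_smul hp
    have := abs_le_of_smul_mem_cube h0 hw.1
    exact ⟨k, by rw [mem_Icc, ← abs_le]; exact_mod_cast this, rfl⟩
  · intro k _ h
    exact mem_filter.2 ⟨mem_cube_of_wt_ne_zero h, parallel_smul p k⟩

/-- The correlation of the dilates of `wt` by `m` and `n`, over non-zero vectors. -/
noncomputable def corr (N m n : ℕ) : ℤ :=
  ∑ q ∈ (cube N).erase 0, wt N ((m : ℤ) • q) * wt N ((n : ℤ) • q)

lemma corr_comm (N m n : ℕ) : corr N m n = corr N n m :=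
  sum_congr rfl fun _ _ => mul_comm _ _

lemma sum_parallel (N : ℕ) :
    ∑ v ∈ cube N, ∑ w ∈ cube N, (if Parallel v w then wt N v * wt N w else 0) =
      2 * (2 * N + 1) * (∑ v ∈ cube N, wt N v) - (2 * N + 1) ^ 2 +
      2 * ∑ d ∈ Icc 1 (2 * N), μ d *
        ∑ g ∈ Icc 1 (2 * N), ∑ k ∈ Icc 1 (2 * N), corr N (d * g) (d * k) := by
  have hz : (0 : ℤ × ℤ × ℤ) ∈ cube N := by simp [mem_cube]
  have hsupp : ∀ v, wt N v ≠ 0 → v ∈ cube N := fun v => mem_cube_of_wt_ne_zero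
  have h0 : ∑ w ∈ cube N, (if Parallel 0 w then wt N 0 * wt N w else 0) =
      (2 * N + 1) * ∑ v ∈ cube N, wt N v := by
    rw [mul_sum, wt_zero]
    exact sum_congr rfl fun w _ => if_pos (by simp [Parallel])
  have h1 : ∑ v ∈ (cube N).erase 0, wt N v = (∑ v ∈ cube N, wt N v) - (2 * N + 1) := by
    rw [← add_sum_erase _ _ hz, wt_zero]; ring
  have h2 : ∑ v ∈ (cube N).erase 0, ∑ w ∈ cube N,
      (if Parallel v w then wt N v * wt N w else 0) =
      (2 * N + 1) * (∑ v ∈ (cube N).erase 0, wt N v) +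
      2 * ∑ g ∈ Icc 1 (2 * N), ∑ k ∈ Icc 1 (2 * N),
        ∑ p ∈ primCube N, wt N (((g : ℕ) : ℤ) • p) * wt N (((k : ℕ) : ℤ) • p) := by
    rw [sum_erase_zero_eq_sum_primCube (wt N) hsupp, sum_erase_zero_eq_sum_primCube, mul_sum,
      mul_sum, ← sum_add_distrib]
    · refine sum_congr rfl fun g hg => ?_
      rw [mem_Icc] at hg
      have hg0 : (g : ℤ) ≠ 0 := by omega
      rw [sum_comm (s := Icc 1 (2 * N)), mul_sum, mul_sum, ← sum_add_distrib]
      refine sum_congr rfl fun p hp => ?_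
      simp only [parallel_smul_left hg0]
      have := sum_parallel_primitive (N := N) (mem_filter.1 hp).2
      rw [← mul_sum]
      calc _ = wt N ((g : ℤ) • p) * ∑ w ∈ cube N, (if Parallel p w then wt N w else 0) := by
            rw [mul_sum]; exact sum_congr rfl fun w _ => by split_ifs <;> simp
        _ = _ := by rw [this]; ring
    · intro v hv
      obtain ⟨w, _, hw⟩ := exists_ne_zero_of_sum_ne_zero hv
      refine hsupp v fun h => hw ?_
      simp [h]
  have h3 : ∀ g ∈ Icc 1 (2 * N), ∀ k ∈ Icc 1 (2 * N),
      ∑ p ∈ primCube N, wt N (((g : ℕ) : ℤ) • p) * wt N (((k : ℕ) : ℤ) • p) =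
      ∑ d ∈ Icc 1 (2 * N), μ d * corr N (d * g) (d * k) := by
    intro g hg k _
    rw [mem_Icc] at hg
    have hg0 : (g : ℤ) ≠ 0 := by omega
    rw [sum_primCube_eq_sum_moebius (fun p => wt N ((g : ℤ) • p) * wt N ((k : ℤ) • p))
      (fun v hv => mem_cube_of_smul_mem hg0 (hsupp _ (left_ne_zero_of_mul hv)))]
    refine sum_congr rfl fun d _ => ?_
    simp only [corr, smul_smul, Nat.cast_mul, mul_comm]
  rw [← add_sum_erase _ _ hz, h0, h2, h1, sum_congr rfl fun g hg => sum_congr rfl (h3 g hg)]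
  have h4 : ∑ g ∈ Icc 1 (2 * N), ∑ k ∈ Icc 1 (2 * N), ∑ d ∈ Icc 1 (2 * N),
      μ d * corr N (d * g) (d * k) = ∑ d ∈ Icc 1 (2 * N), μ d *
        ∑ g ∈ Icc 1 (2 * N), ∑ k ∈ Icc 1 (2 * N), corr N (d * g) (d * k) := by
    simp only [mul_sum]
    rw [sum_congr rfl fun g _ => sum_comm, sum_comm]
  rw [h4]
  ring

lemma sum_sub_eq_sum_tent (N : ℕ) (h : ℤ → ℤ) :
    ∑ a ∈ Icc (-(N : ℤ)) N, ∑ d ∈ Icc (-(N : ℤ)) N, h (a - d) =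
      ∑ u ∈ Icc (-((2 * N : ℕ) : ℤ)) ((2 * N : ℕ) : ℤ), tent N u * h u := by
  have h1 : ∀ a ∈ Icc (-(N : ℤ)) N, ∑ d ∈ Icc (-(N : ℤ)) N, h (a - d) =
      ∑ u ∈ Icc (-((2 * N : ℕ) : ℤ)) ((2 * N : ℕ) : ℤ),
        if a - u ∈ Icc (-(N : ℤ)) N then h u else 0 := by
    intro a ha
    rw [← sum_filter]
    rw [mem_Icc] at ha
    refine sum_nbij' (fun d => a - d) (fun u => a - u) ?_ ?_ ?_ ?_ ?_
    · intro d hd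
      simp only [mem_Icc, mem_filter] at hd ⊢
      omega
    · intro d hd
      exact (mem_filter.1 hd).2
    all_goals simp
  rw [sum_congr rfl h1, sum_comm]
  refine sum_congr rfl fun u hu => ?_
  rw [mem_Icc] at hu
  rw [← sum_filter, sum_const, nsmul_eq_mul]
  congr 1
  have h2 : (Icc (-(N : ℤ)) N).filter (fun a => a - u ∈ Icc (-(N : ℤ)) N) =
      Icc (max (-(N : ℤ)) (u - N)) (min (N : ℤ) (N + u)) := by
    ext a
    simp only [mem_filter, mem_Icc, max_le_iff, le_min_iff]
    omega
  rw [h2, Int.card_Icc, tent]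
  rcases abs_cases u with h | h <;> omega

lemma sum_Icc_eq_sum_boxWt (N : ℕ) (f : ℤ → ℤ) :
    ∑ x ∈ Icc (-(N : ℤ)) N, f x =
      ∑ x ∈ Icc (-((2 * N : ℕ) : ℤ)) ((2 * N : ℕ) : ℤ), boxWt N x * f x := by
  simp only [boxWt, ite_mul, one_mul, zero_mul]
  rw [← sum_filter]
  congr 1
  ext x
  simp only [mem_filter, mem_Icc, abs_le]
  omega

/-- The quadruples of integers in `[-N, N]`. -/
noncomputable def quads (N : ℕ) : Finset (ℤ × ℤ × ℤ × ℤ) :=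
  Icc (-(N : ℤ)) N ×ˢ (Icc (-(N : ℤ)) N ×ˢ (Icc (-(N : ℤ)) N ×ˢ Icc (-(N : ℤ)) N))

lemma sum_quads (N : ℕ) (g : ℤ × ℤ × ℤ → ℤ) :
    ∑ x ∈ quads N, g (x.1, x.2.1, x.2.2.1 - x.2.2.2) = ∑ v ∈ cube N, wt N v * g v := by
  simp only [quads, cube, sum_product]
  rw [sum_Icc_eq_sum_boxWt]
  refine sum_congr rfl fun b _ => ?_
  rw [sum_Icc_eq_sum_boxWt, mul_sum]
  refine sum_congr rfl fun c _ => ?_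
  rw [sum_sub_eq_sum_tent N (fun u => g (b, c, u)), mul_sum, mul_sum]
  refine sum_congr rfl fun u _ => ?_
  simp only [wt]
  ring

/-- The matrix with off-diagonal entries `x.1`, `x.2.1` and diagonal entries `x.2.2`. -/
def quadMatrix (x : ℤ × ℤ × ℤ × ℤ) : Matrix (Fin 2) (Fin 2) ℤ :=
  !![x.2.2.1, x.1; x.2.1, x.2.2.2]

lemma quadMatrix_injective : Function.Injective quadMatrix := by
  rintro ⟨b, c, a, d⟩ ⟨b', c', a', d'⟩ h
  have h1 := congr_fun₂ h 0 0
  have h2 := congr_fun₂ h 0 1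
  have h3 := congr_fun₂ h 1 0
  have h4 := congr_fun₂ h 1 1
  simp [quadMatrix] at h1 h2 h3 h4
  simp [*]

lemma exists_quadMatrix {N : ℕ} {A : Matrix (Fin 2) (Fin 2) ℤ} :
    (∀ i j, |A i j| ≤ (N : ℤ)) ↔ ∃ x ∈ quads N, quadMatrix x = A := by
  constructor
  · intro h
    refine ⟨(A 0 1, A 1 0, A 0 0, A 1 1), ?_, ?_⟩
    · simp only [quads, mem_product, mem_Icc, ← abs_le]
      exact ⟨h _ _, h _ _, h _ _, h _ _⟩
    · simp [quadMatrix, ← Matrix.eta_fin_two]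
  · rintro ⟨x, hx, rfl⟩
    simp only [quads, mem_product, mem_Icc, ← abs_le] at hx
    simp [quadMatrix, Fin.forall_fin_two, hx]

lemma quadMatrix_mul_comm_iff (x y : ℤ × ℤ × ℤ × ℤ) :
    quadMatrix x * quadMatrix y = quadMatrix y * quadMatrix x ↔
      Parallel (x.1, x.2.1, x.2.2.1 - x.2.2.2) (y.1, y.2.1, y.2.2.1 - y.2.2.2) := by
  obtain ⟨b, c, a, d⟩ := x
  obtain ⟨b', c', a', d'⟩ := y
  simp only [quadMatrix, Matrix.mul_fin_two, Parallel, ← Matrix.ext_iff, Fin.forall_fin_two,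
    Matrix.of_apply, Matrix.cons_val', Matrix.cons_val_zero, Matrix.cons_val_one,
    Matrix.cons_val_fin_one]
  constructor
  · rintro ⟨⟨h1, h2⟩, h3, h4⟩
    refine ⟨by linear_combination h1, by linear_combination -h2, by linear_combination h3⟩
  · rintro ⟨h1, h2, h3⟩
    refine ⟨⟨by linear_combination h1, by linear_combination -h2⟩, by linear_combination h3,
      by linear_combination -h1⟩

lemma matCommCount_two (N : ℕ) : (matCommCount 2 N : ℤ) =
    ∑ v ∈ cube N, ∑ w ∈ cube N, if Parallel v w then wt N v * wt N w else 0 := by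
  have h1 : matCommCount 2 N = #((quads N ×ˢ quads N).filter fun x =>
      quadMatrix x.1 * quadMatrix x.2 = quadMatrix x.2 * quadMatrix x.1) := by
    rw [← card_image_of_injective _ (quadMatrix_injective.prodMap quadMatrix_injective)]
    refine Nat.subtype_card _ ?_
    rintro ⟨A, B⟩
    rw [exists_quadMatrix, exists_quadMatrix]
    rw [mem_image]
    constructor
    · rintro ⟨⟨x, y⟩, hxy, h⟩
      rw [mem_filter, mem_product] at hxy
      obtain ⟨rfl, rfl⟩ := Prod.mk.inj h
      exact ⟨⟨x, hxy.1.1, rfl⟩, ⟨y, hxy.1.2, rfl⟩, hxy.2⟩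
    · rintro ⟨⟨x, hx, hxA⟩, ⟨y, hy, hyB⟩, h⟩
      refine ⟨(x, y), mem_filter.2 ⟨mem_product.2 ⟨hx, hy⟩, ?_⟩, Prod.ext hxA hyB⟩
      rw [hxA, hyB, h]
  rw [h1, card_filter]
  push_cast
  rw [sum_product]
  simp only [quadMatrix_mul_comm_iff]
  have h2 : ∀ v : ℤ × ℤ × ℤ, ∑ y ∈ quads N,
      (if Parallel v (y.1, y.2.1, y.2.2.1 - y.2.2.2) then (1 : ℤ) else 0) =
      ∑ w ∈ cube N, wt N w * if Parallel v w then 1 else 0 := fun v =>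
    sum_quads N (fun w => if Parallel v w then 1 else 0)
  simp only [h2]
  rw [sum_quads N (fun v => ∑ w ∈ cube N, wt N w * if Parallel v w then 1 else 0)]
  refine sum_congr rfl fun v _ => ?_
  rw [mul_sum]
  exact sum_congr rfl fun w _ => by split_ifs <;> simp

lemma sum_wt (N : ℕ) : ∑ v ∈ cube N, wt N v = (2 * N + 1) ^ 4 := by
  have := sum_quads N (fun _ => 1)
  simp only [mul_one] at this
  rw [← this]
  simp only [quads, sum_const, card_product, Int.card_Icc, nsmul_eq_mul]
  have h : (((N : ℤ) + 1 - -N).toNat : ℤ) = 2 * N + 1 := by omega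
  push_cast
  rw [Int.toNat_of_nonneg (by omega)]
  ring

lemma abs_natCast_mul_le {K m : ℕ} (hm : 1 ≤ m) (x : ℤ) :
    |(m : ℤ) * x| ≤ K ↔ x ∈ Icc (-((K / m : ℕ) : ℤ)) ((K / m : ℕ) : ℤ) := by
  rw [mem_Icc, ← abs_le, abs_mul, Nat.abs_cast, Int.abs_eq_natAbs]
  norm_cast
  rw [Nat.le_div_iff_mul_le (by omega), mul_comm]

lemma sum_boxWt (N m n : ℕ) (hm : 1 ≤ m) (hn : n ≤ m) :
    ∑ x ∈ Icc (-((2 * N : ℕ) : ℤ)) ((2 * N : ℕ) : ℤ), boxWt N (m * x) * boxWt N (n * x) =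
      2 * ((N / m : ℕ) : ℤ) + 1 := by
  have h1 : ∀ x : ℤ, boxWt N (m * x) * boxWt N (n * x) =
      if x ∈ Icc (-((N / m : ℕ) : ℤ)) ((N / m : ℕ) : ℤ) then 1 else 0 := by
    intro x
    simp only [← abs_natCast_mul_le hm]
    have : |(n : ℤ) * x| ≤ |(m : ℤ) * x| := by
      rw [abs_mul, abs_mul, Nat.abs_cast, Nat.abs_cast]
      gcongr
    by_cases h : |(m : ℤ) * x| ≤ N
    · rw [boxWt, boxWt, if_pos h, if_pos (this.trans h), one_mul]
    · rw [boxWt, if_neg h, zero_mul]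
  rw [sum_congr rfl fun x _ => h1 x, ← sum_filter]
  have h2 := Nat.div_le_self N m
  have h3 : (Icc (-((2 * N : ℕ) : ℤ)) ((2 * N : ℕ) : ℤ)).filter
      (· ∈ Icc (-((N / m : ℕ) : ℤ)) ((N / m : ℕ) : ℤ)) =
      Icc (-((N / m : ℕ) : ℤ)) ((N / m : ℕ) : ℤ) := by
    ext x; simp only [mem_filter, mem_Icc]; omega
  rw [h3]
  simp only [sum_const, Int.card_Icc, nsmul_eq_mul, mul_one]
  generalize N / m = q
  omega

lemma tent_of_abs_le {N : ℕ} {u : ℤ} (h : |u| ≤ (2 * N : ℕ)) : tent N u = 2 * N + 1 - |u| := by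
  rw [tent]; push_cast at h; omega

lemma tent_of_lt_abs {N : ℕ} {u : ℤ} (h : ¬ |u| ≤ (2 * N : ℕ)) : tent N u = 0 := by
  rw [tent]; push_cast at h; omega

lemma sum_tent (N m n : ℕ) (hm : 1 ≤ m) (hn : n ≤ m) :
    3 * ∑ u ∈ Icc (-((2 * N : ℕ) : ℤ)) ((2 * N : ℕ) : ℤ), tent N (m * u) * tent N (n * u) =
      3 * (2 * N + 1) ^ 2 + 6 * ((2 * N / m : ℕ) : ℤ) * (2 * N + 1) ^ 2 -
      3 * (m + n) * (2 * N + 1) * ((2 * N / m : ℕ) * ((2 * N / m : ℕ) + 1)) +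
      m * n * ((2 * N / m : ℕ) * ((2 * N / m : ℕ) + 1) * (2 * (2 * N / m : ℕ) + 1)) := by
  set r := 2 * N / m with hr
  have hrM : r ≤ 2 * N := Nat.div_le_self _ _
  have h1 : ∑ u ∈ Icc (-((2 * N : ℕ) : ℤ)) ((2 * N : ℕ) : ℤ), tent N (m * u) * tent N (n * u) =
      ∑ u ∈ Icc (-(r : ℤ)) r, (2 * (N : ℤ) + 1 - m * |u|) * (2 * N + 1 - n * |u|) := by
    symm
    have hsub : Icc (-(r : ℤ)) r ⊆ Icc (-((2 * N : ℕ) : ℤ)) ((2 * N : ℕ) : ℤ) :=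
      Icc_subset_Icc (by omega) (by omega)
    rw [← sum_subset hsub]
    · refine sum_congr rfl fun u hu => ?_
      rw [← abs_natCast_mul_le hm] at hu
      have : |(n : ℤ) * u| ≤ |(m : ℤ) * u| := by
        rw [abs_mul, abs_mul, Nat.abs_cast, Nat.abs_cast]
        gcongr
      rw [tent_of_abs_le hu, tent_of_abs_le (this.trans hu), abs_mul, abs_mul, Nat.abs_cast,
        Nat.abs_cast]
    · intro u _ hu
      rw [← abs_natCast_mul_le hm] at hu
      rw [tent_of_lt_abs hu, zero_mul]
  have h2 : ∀ r : ℕ, 6 * ∑ k ∈ Icc 1 r, (2 * (N : ℤ) + 1 - m * |((k : ℕ) : ℤ)|) *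
      (2 * N + 1 - n * |((k : ℕ) : ℤ)|) = 6 * r * (2 * N + 1) ^ 2 -
      3 * (m + n) * (2 * N + 1) * (r * (r + 1)) + m * n * (r * (r + 1) * (2 * r + 1)) := by
    intro r
    simp only [Nat.abs_cast]
    induction r with
    | zero => simp
    | succ r ih =>
      rw [Finset.sum_Icc_succ_top (by omega), mul_add, ih]
      push_cast
      ring
  rw [h1, sum_Icc_neg_of_even _ (fun u => by rw [abs_neg])]
  have := h2 r
  simp only [abs_zero]
  linear_combination this

lemma corr_eq (N m n : ℕ) :
    corr N m n =
      (∑ x ∈ Icc (-((2 * N : ℕ) : ℤ)) ((2 * N : ℕ) : ℤ), boxWt N (m * x) * boxWt N (n * x)) ^ 2 *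
      (∑ u ∈ Icc (-((2 * N : ℕ) : ℤ)) ((2 * N : ℕ) : ℤ), tent N (m * u) * tent N (n * u)) -
      (2 * N + 1) ^ 2 := by
  have hz : (0 : ℤ × ℤ × ℤ) ∈ cube N := by simp [mem_cube]
  have h := add_sum_erase (cube N)
    (fun q => wt N ((m : ℤ) • q) * wt N ((n : ℤ) • q)) hz
  have h1 : ∑ q ∈ cube N, wt N ((m : ℤ) • q) * wt N ((n : ℤ) • q) =
      (∑ x ∈ Icc (-((2 * N : ℕ) : ℤ)) ((2 * N : ℕ) : ℤ), boxWt N (m * x) * boxWt N (n * x)) ^ 2 *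
      (∑ u ∈ Icc (-((2 * N : ℕ) : ℤ)) ((2 * N : ℕ) : ℤ), tent N (m * u) * tent N (n * u)) := by
    have h2 : ∀ x y u : ℤ, wt N ((m : ℤ) • (x, y, u)) * wt N ((n : ℤ) • (x, y, u)) =
        (boxWt N (m * x) * boxWt N (n * x)) * ((boxWt N (m * y) * boxWt N (n * y)) *
          (tent N (m * u) * tent N (n * u))) := by
      intro x y u
      simp only [wt, Prod.smul_mk, smul_eq_mul]
      ring
    simp only [cube, sum_product, h2, ← mul_sum, ← sum_mul]
    ring
  rw [h1] at h
  simp only [smul_zero, wt_zero] at h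
  rw [corr]
  linear_combination h

lemma tent_estimate {M m n X r t : ℝ} (hm : 1 ≤ m) (ht0 : 0 ≤ t) (ht1 : t ≤ 1) (hX : 1 ≤ X)
    (hmX : m * X = M) (hn : n = t * m) (hr : r ≤ X) (hr1 : X < r + 1) :
    |((M + 1) ^ 2 + 2 * r * (M + 1) ^ 2 - (m + n) * (M + 1) * (r * (r + 1)) +
      m * n / 3 * (r * (r + 1) * (2 * r + 1))) - M ^ 2 * X * (1 - t / 3)| ≤ 26 * M ^ 2 := by
  have hXM : X ≤ M := by rw [← hmX]; nlinarith
  have hM : 1 ≤ M := hX.trans hXM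
  have hr0 : 0 ≤ r := by linarith
  have hL : (M + 1) ^ 2 ≤ 4 * M ^ 2 := by nlinarith
  have e1 : |r * (M + 1) ^ 2 - X * M ^ 2| ≤ 7 * M ^ 2 := by
    rw [abs_le]; constructor <;> nlinarith
  have e2 : |(M + 1) * (r * (r + 1)) - M * X ^ 2| ≤ 3 * (M * X) := by
    have h1 : r * (r + 1) ≤ X * (X + 1) := by nlinarith
    have h2 : (X - 1) * X ≤ r * (r + 1) := by nlinarith
    rw [abs_le]; constructor <;> nlinarith
  have e3 : |r * (r + 1) * (2 * r + 1) - 2 * X ^ 3| ≤ 4 * X ^ 2 := by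
    have h1 : r * (r + 1) ≤ X * (X + 1) := by nlinarith
    have h2 : (X - 1) * X ≤ r * (r + 1) := by nlinarith
    have h3 : 0 ≤ (X - 1) * X := by nlinarith
    have h4 : r * (r + 1) * (2 * r + 1) ≤ X * (X + 1) * (2 * X + 1) := by gcongr
    have h5 : (X - 1) * X * (2 * X - 1) ≤ r * (r + 1) * (2 * r + 1) := by
      apply mul_le_mul h2 (by linarith) (by linarith) (by nlinarith)
    rw [abs_le]; constructor <;> nlinarith
  have key : ((M + 1) ^ 2 + 2 * r * (M + 1) ^ 2 - (m + n) * (M + 1) * (r * (r + 1)) +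
      m * n / 3 * (r * (r + 1) * (2 * r + 1))) - M ^ 2 * X * (1 - t / 3) =
      (M + 1) ^ 2 + 2 * (r * (M + 1) ^ 2 - X * M ^ 2) -
      (1 + t) * (m * ((M + 1) * (r * (r + 1)) - M * X ^ 2)) +
      t / 3 * (m ^ 2 * (r * (r + 1) * (2 * r + 1) - 2 * X ^ 3)) := by
    subst hn hmX; ring
  have f2 : |m * ((M + 1) * (r * (r + 1)) - M * X ^ 2)| ≤ 3 * M ^ 2 := by
    rw [abs_mul, abs_of_nonneg (by linarith)]
    calc m * _ ≤ m * (3 * (M * X)) := by gcongr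
      _ = 3 * M ^ 2 := by subst hmX; ring
  have f3 : |m ^ 2 * (r * (r + 1) * (2 * r + 1) - 2 * X ^ 3)| ≤ 4 * M ^ 2 := by
    rw [abs_mul, abs_of_nonneg (by positivity)]
    calc m ^ 2 * _ ≤ m ^ 2 * (4 * X ^ 2) := by gcongr
      _ = 4 * M ^ 2 := by subst hmX; ring
  rw [key]
  generalize m * ((M + 1) * (r * (r + 1)) - M * X ^ 2) = A at *
  generalize m ^ 2 * (r * (r + 1) * (2 * r + 1) - 2 * X ^ 3) = B at *
  rw [abs_le] at *
  constructor <;> nlinarith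

lemma corr_estimate_real {M m n X q r t : ℝ} (hm : 1 ≤ m) (ht0 : 0 ≤ t) (ht1 : t ≤ 1)
    (hX : 1 ≤ X) (hmX : m * X = M) (hn : n = t * m) (hr : r ≤ X) (hr1 : X < r + 1)
    (hq : 2 * q ≤ X) (hq1 : X < 2 * q + 2) :
    |(2 * q + 1) ^ 2 *
      ((M + 1) ^ 2 + 2 * r * (M + 1) ^ 2 - (m + n) * (M + 1) * (r * (r + 1)) +
        m * n / 3 * (r * (r + 1) * (2 * r + 1))) - (M + 1) ^ 2 -
      M ^ 2 * X ^ 3 * (1 - t / 3)| ≤ 120 * (M ^ 2 * X ^ 2) := by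
  have hS := tent_estimate hm ht0 ht1 hX hmX hn hr hr1
  generalize (M + 1) ^ 2 + 2 * r * (M + 1) ^ 2 - (m + n) * (M + 1) * (r * (r + 1)) +
        m * n / 3 * (r * (r + 1) * (2 * r + 1)) = S at *
  have hXM : X ≤ M := by rw [← hmX]; nlinarith
  have hM : 1 ≤ M := hX.trans hXM
  have hL : (M + 1) ^ 2 ≤ 4 * (M ^ 2 * X ^ 2) := by
    have : M ^ 2 * 1 ≤ M ^ 2 * X ^ 2 := by gcongr; exact one_le_pow₀ hX
    nlinarith
  have hP : |(2 * q + 1) ^ 2 - X ^ 2| ≤ 3 * X := by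
    rw [abs_le]; constructor <;> nlinarith
  have hS' : |S| ≤ 27 * (M ^ 2 * X) := by
    have h1 : 0 ≤ M ^ 2 * X * (1 - t / 3) := by
      have : 0 ≤ 1 - t / 3 := by linarith
      positivity
    have h2 : M ^ 2 * X * (1 - t / 3) ≤ M ^ 2 * X := by
      apply mul_le_of_le_one_right (by positivity); linarith
    have h3 : M ^ 2 ≤ M ^ 2 * X := by nlinarith [sq_nonneg M]
    rw [abs_le] at *
    constructor <;> linarith
  have e : (2 * q + 1) ^ 2 * S - (M + 1) ^ 2 - M ^ 2 * X ^ 3 * (1 - t / 3) =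
      ((2 * q + 1) ^ 2 - X ^ 2) * S + X ^ 2 * (S - M ^ 2 * X * (1 - t / 3)) - (M + 1) ^ 2 := by
    ring
  rw [e]
  have g1 : |((2 * q + 1) ^ 2 - X ^ 2) * S| ≤ 3 * X * (27 * (M ^ 2 * X)) := by
    rw [abs_mul]; gcongr
  have g2 : |X ^ 2 * (S - M ^ 2 * X * (1 - t / 3))| ≤ X ^ 2 * (26 * M ^ 2) := by
    rw [abs_mul, abs_of_nonneg (sq_nonneg X)]; gcongr
  rw [abs_le] at g1 g2 ⊢
  constructor <;> nlinarith [sq_nonneg (M + 1)]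

lemma corr_estimate {N m n : ℕ} (hN : 1 ≤ N) (hn1 : 1 ≤ n) (hn : n ≤ m) :
    |(corr N m n : ℝ) - (2 * N : ℝ) ^ 5 * ((1 - n / (3 * m)) / (m : ℝ) ^ 3)| ≤
      120 * (2 * N : ℝ) ^ 4 * (1 / (m : ℝ) ^ 2) := by
  have hm : 1 ≤ m := hn1.trans hn
  have hmR : (1 : ℝ) ≤ m := by exact_mod_cast hm
  have hNR : (1 : ℝ) ≤ N := by exact_mod_cast hN
  have hnR : (n : ℝ) ≤ m := by exact_mod_cast hn
  have ht1 : (n : ℝ) / m ≤ 1 := div_le_one_of_le₀ hnR (by positivity)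
  have ht0 : (0 : ℝ) ≤ n / m := by positivity
  have hc : (corr N m n : ℝ) = (2 * ((N / m : ℕ) : ℝ) + 1) ^ 2 *
      ((2 * N + 1 : ℝ) ^ 2 + 2 * ((2 * N / m : ℕ) : ℝ) * (2 * N + 1) ^ 2 -
      (m + n) * (2 * N + 1) * (((2 * N / m : ℕ) : ℝ) * (((2 * N / m : ℕ) : ℝ) + 1)) +
      m * n / 3 * (((2 * N / m : ℕ) : ℝ) * (((2 * N / m : ℕ) : ℝ) + 1) *
        (2 * ((2 * N / m : ℕ) : ℝ) + 1))) - (2 * N + 1) ^ 2 := by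
    have h := congrArg (Int.cast : ℤ → ℝ) (sum_tent N m n hm hn)
    rw [corr_eq, sum_boxWt N m n hm hn]
    generalize ∑ u ∈ Icc (-((2 * N : ℕ) : ℤ)) ((2 * N : ℕ) : ℤ),
      tent N (m * u) * tent N (n * u) = S at h ⊢
    generalize 2 * N / m = r at h ⊢
    generalize N / m = q at h ⊢
    push_cast at h ⊢
    linear_combination (2 * (q : ℝ) + 1) ^ 2 * h / 3
  rw [hc]
  have hmain : (2 * N : ℝ) ^ 5 * ((1 - n / (3 * m)) / (m : ℝ) ^ 3) =
      (2 * N) ^ 2 * (2 * N / m : ℝ) ^ 3 * (1 - n / m / 3) := by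
    field_simp
  have herr : 120 * (2 * N : ℝ) ^ 4 * (1 / (m : ℝ) ^ 2) =
      120 * ((2 * N) ^ 2 * (2 * N / m : ℝ) ^ 2) := by
    field_simp
  rw [hmain, herr]
  by_cases h : m ≤ 2 * N
  · have hmN : (m : ℝ) ≤ 2 * N := by exact_mod_cast h
    have hr := Nat.div_mul_le_self (2 * N) m
    have hr1 := Nat.lt_div_mul_add (a := 2 * N) (b := m) (by omega)
    have hq := Nat.div_mul_le_self N m
    have hq1 := Nat.lt_div_mul_add (a := N) (b := m) (by omega)
    generalize 2 * N / m = r at *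
    generalize N / m = q at *
    refine corr_estimate_real hmR ht0 ht1 ((one_le_div (by positivity)).2 hmN) (by field_simp)
      (by field_simp) ?_ ?_ ?_ ?_
    · rw [le_div_iff₀ (by positivity)]; exact_mod_cast hr
    · rw [div_lt_iff₀ (by positivity), add_one_mul]; exact_mod_cast hr1
    · rw [le_div_iff₀ (by positivity)]; norm_cast; linarith
    · rw [div_lt_iff₀ (by positivity)]; norm_cast; linarith
  · have hmN : (2 * N : ℝ) ≤ m := by exact_mod_cast (not_le.1 h).le
    rw [Nat.div_eq_of_lt (not_le.1 h), Nat.div_eq_of_lt (by omega)]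
    have hX1 : (2 * N / m : ℝ) ≤ 1 := div_le_one_of_le₀ hmN (by positivity)
    have hX0 : (0 : ℝ) ≤ 2 * N / m := by positivity
    generalize (2 * N / m : ℝ) = X at *
    generalize (n / m : ℝ) = t at *
    have e : (2 * ((0 : ℕ) : ℝ) + 1) ^ 2 * ((2 * N + 1 : ℝ) ^ 2 +
      2 * ((0 : ℕ) : ℝ) * (2 * N + 1) ^ 2 -
      (m + n) * (2 * N + 1) * (((0 : ℕ) : ℝ) * (((0 : ℕ) : ℝ) + 1)) +
      m * n / 3 * (((0 : ℕ) : ℝ) * (((0 : ℕ) : ℝ) + 1) *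
        (2 * ((0 : ℕ) : ℝ) + 1))) - (2 * N + 1) ^ 2 - (2 * N) ^ 2 * X ^ 3 * (1 - t / 3) =
        -((2 * N) ^ 2 * (X ^ 2 * (X * (1 - t / 3)))) := by
      push_cast; ring
    have h1 : 0 ≤ X * (1 - t / 3) := mul_nonneg hX0 (by linarith)
    have h2 : X * (1 - t / 3) ≤ 1 := mul_le_one₀ hX1 (by linarith) (by linarith)
    rw [e, abs_neg, abs_of_nonneg (by positivity)]
    have h3 : (2 * N : ℝ) ^ 2 * (X ^ 2 * (X * (1 - t / 3))) ≤ (2 * N) ^ 2 * (X ^ 2 * 1) := by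
      gcongr
    have h4 : 0 ≤ (2 * N : ℝ) ^ 2 * X ^ 2 := by positivity
    linarith

lemma hasSum_zetaNat {s : ℕ} (hs : 1 < s) :
    HasSum (fun n : ℕ => 1 / ((n : ℝ) + 1) ^ s) (zetaNat s) := by
  have h := (summable_nat_add_iff 1).2 (Real.summable_one_div_nat_pow.2 hs)
  simp only [Nat.cast_add, Nat.cast_one] at h
  exact h.hasSum

lemma zetaNat_three_pos : 0 < zetaNat 3 :=
  (hasSum_zetaNat (by norm_num)).summable.tsum_pos (fun _ => by positivity) 0 (by norm_num)

lemma riemannZeta_three : riemannZeta 3 = (zetaNat 3 : ℂ) := by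
  rw [zeta_eq_tsum_one_div_nat_add_one_cpow (by norm_num), zetaNat, Complex.ofReal_tsum]
  refine tsum_congr fun n => ?_
  rw [show (3 : ℂ) = ((3 : ℕ) : ℂ) by norm_num, Complex.cpow_natCast]
  push_cast
  rfl

lemma hasSum_moebius_div_cube :
    HasSum (fun n : ℕ => (μ (n + 1) : ℝ) / ((n + 1 : ℕ) : ℝ) ^ 3) (1 / zetaNat 3) := by
  have hre : (1 : ℝ) < (3 : ℂ).re := by norm_num
  have h1 := LSeries_one_mul_Lseries_moebius hre
  have h2 : LSeriesSummable (fun n => ((μ n : ℤ) : ℂ)) 3 :=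
    ArithmeticFunction.LSeriesSummable_moebius_iff.2 hre
  have hz : (zetaNat 3 : ℂ) ≠ 0 := by exact_mod_cast zetaNat_three_pos.ne'
  rw [LSeries_one_eq_riemannZeta hre, riemannZeta_three] at h1
  have h3 : HasSum (LSeries.term (fun n => ((μ n : ℤ) : ℂ)) 3) (1 / zetaNat 3 : ℂ) := by
    rw [← h1, mul_div_cancel_left₀ _ hz]
    exact h2.hasSum
  rw [← hasSum_nat_add_iff' 1] at h3
  simp only [sum_range_one, LSeries.term_zero, sub_zero] at h3
  rw [← Complex.hasSum_ofReal]
  have e : (fun n : ℕ => (((μ (n + 1) : ℝ) / ((n + 1 : ℕ) : ℝ) ^ 3 : ℝ) : ℂ)) =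
      fun n => LSeries.term (fun n => ((μ n : ℤ) : ℂ)) 3 (n + 1) := by
    funext n
    rw [LSeries.term_of_ne_zero (Nat.succ_ne_zero n), show (3 : ℂ) = ((3 : ℕ) : ℂ) by norm_num,
      Complex.cpow_natCast]
    push_cast
    rfl
  rw [e]
  push_cast
  exact h3

lemma sum_inv_sq_le_two {M : ℕ} (hM : 1 ≤ M) : ∑ d ∈ Icc 1 M, 1 / (d : ℝ) ^ 2 ≤ 2 := by
  have h : Icc 1 M = insert 1 (Ioc 1 M) := by
    ext; simp only [mem_Icc, mem_insert, mem_Ioc]; omega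
  rw [h, sum_insert (by simp)]
  have h1 := sum_Ioc_inv_sq_le_sub (α := ℝ) one_ne_zero hM
  have h2 : (0 : ℝ) ≤ (M : ℝ)⁻¹ := by positivity
  simp only [one_div, Nat.cast_one, one_pow, inv_one] at h1 ⊢
  linarith

lemma sum_max_inv_sq_le {M : ℕ} :
    ∑ g ∈ Icc 1 M, ∑ k ∈ Icc 1 M, 1 / ((max g k : ℕ) : ℝ) ^ 2 ≤ 2 * (1 + Real.log M) := by
  rw [sum_max_min (fun m _ => 1 / (m : ℝ) ^ 2)]
  have h := harmonic_le_one_add_log M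
  rw [harmonic_eq_sum_Icc] at h
  push_cast at h
  refine le_trans ?_ (mul_le_mul_of_nonneg_left h (by norm_num))
  rw [mul_sum]
  refine sum_le_sum fun m hm => ?_
  rw [mem_Icc] at hm
  have hm0 : (1 : ℝ) ≤ m := by exact_mod_cast hm.1
  rw [sum_const, Nat.card_Ico, nsmul_eq_mul, Nat.cast_sub hm.1]
  have : 1 / (m : ℝ) ^ 2 + 2 * (((m : ℝ) - ((1 : ℕ) : ℝ)) * (1 / (m : ℝ) ^ 2)) =
      2 * (m : ℝ)⁻¹ - 1 / (m : ℝ) ^ 2 := by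
    push_cast; field_simp; ring
  rw [this]
  have : 0 ≤ 1 / (m : ℝ) ^ 2 := by positivity
  linarith

lemma sum_mainTerm (M : ℕ) :
    ∑ g ∈ Icc 1 M, ∑ k ∈ Icc 1 M,
      (1 - ((min g k : ℕ) : ℝ) / (3 * ((max g k : ℕ) : ℝ))) / ((max g k : ℕ) : ℝ) ^ 3 =
      ∑ m ∈ Icc 1 M, (5 / 3 * (1 / (m : ℝ) ^ 2) - 1 / (m : ℝ) ^ 3) := by
  rw [sum_max_min (fun m n => (1 - (n : ℝ) / (3 * (m : ℝ))) / (m : ℝ) ^ 3)]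
  refine sum_congr rfl fun m hm => ?_
  rw [mem_Icc] at hm
  obtain ⟨r, rfl⟩ : ∃ r, m = r + 1 := ⟨m - 1, by omega⟩
  have h : ∀ x : ℝ, ∀ r : ℕ, ∑ n ∈ Ico 1 (r + 1), (1 - (n : ℝ) / (3 * x)) / x ^ 3 =
      (r - r * (r + 1) / 2 / (3 * x)) / x ^ 3 := by
    intro x r
    induction r with
    | zero => simp
    | succ r ih =>
      rw [sum_Ico_succ_top (by omega), ih]
      push_cast
      ring
  rw [h]
  have hx : (((r + 1 : ℕ) : ℝ)) ≠ 0 := by positivity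
  have hr : (r : ℝ) = ((r + 1 : ℕ) : ℝ) - 1 := by push_cast; ring
  rw [hr]
  generalize ((r + 1 : ℕ) : ℝ) = x at hx
  field_simp
  ring

lemma sum_corr_estimate {N d : ℕ} (hN : 1 ≤ N) (hd : 1 ≤ d) (M : ℕ) :
    |((∑ g ∈ Icc 1 M, ∑ k ∈ Icc 1 M, corr N (d * g) (d * k) : ℤ) : ℝ) -
      (2 * N : ℝ) ^ 5 * (1 / (d : ℝ) ^ 3) *
        ∑ m ∈ Icc 1 M, (5 / 3 * (1 / (m : ℝ) ^ 2) - 1 / (m : ℝ) ^ 3)| ≤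
      240 * (2 * N : ℝ) ^ 4 * (1 + Real.log M) * (1 / (d : ℝ) ^ 2) := by
  rw [← sum_mainTerm]
  have hd0 : (d : ℝ) ≠ 0 := by positivity
  push_cast
  simp only [mul_sum, ← sum_sub_distrib]
  calc _ ≤ ∑ g ∈ Icc 1 M, ∑ k ∈ Icc 1 M,
        120 * (2 * N : ℝ) ^ 4 * (1 / (d : ℝ) ^ 2) * (1 / ((max g k : ℕ) : ℝ) ^ 2) := by
        refine (abs_sum_le_sum_abs _ _).trans (sum_le_sum fun g hg =>
          (abs_sum_le_sum_abs _ _).trans (sum_le_sum fun k hk => ?_))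
        rw [mem_Icc] at hg hk
        have hc : corr N (d * g) (d * k) = corr N (d * max g k) (d * min g k) := by
          rcases le_total g k with h | h
          · rw [max_eq_right h, min_eq_left h, corr_comm]
          · rw [max_eq_left h, min_eq_right h]
        have hmin : 1 ≤ min g k := le_min hg.1 hk.1
        have hmax : (((max g k : ℕ)) : ℝ) ≠ 0 := by
          have : 1 ≤ max g k := hmin.trans min_le_max
          positivity
        have h := corr_estimate (m := d * max g k) (n := d * min g k) hN
          (Nat.mul_pos hd hmin) (Nat.mul_le_mul_left d min_le_max)
        rw [hc]
        rw [Nat.cast_mul d, Nat.cast_mul d] at h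
        rw [← Nat.cast_max, ← Nat.cast_min]
        have e1 : ∀ x y : ℝ, x ≠ 0 → (2 * N : ℝ) ^ 5 * (1 / (d : ℝ) ^ 3) *
            ((1 - y / (3 * x)) / x ^ 3) =
            (2 * N : ℝ) ^ 5 * ((1 - d * y / (3 * (d * x))) / (d * x) ^ 3) := by
          intro x y hx
          field_simp
        have e2 : ∀ x : ℝ, x ≠ 0 → 120 * (2 * N : ℝ) ^ 4 * (1 / (d : ℝ) ^ 2) * (1 / x ^ 2) =
            120 * (2 * N : ℝ) ^ 4 * (1 / (d * x) ^ 2) := by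
          intro x hx
          field_simp
        rw [e1 _ _ hmax, e2 _ hmax]
        exact h
    _ = 120 * (2 * N : ℝ) ^ 4 * (1 / (d : ℝ) ^ 2) *
        ∑ g ∈ Icc 1 M, ∑ k ∈ Icc 1 M, 1 / ((max g k : ℕ) : ℝ) ^ 2 := by
        simp only [mul_sum]
    _ ≤ 120 * (2 * N : ℝ) ^ 4 * (1 / (d : ℝ) ^ 2) * (2 * (1 + Real.log M)) := by
        gcongr; exact sum_max_inv_sq_le
    _ = _ := by ring

lemma sum_moebius_corr_estimate {N : ℕ} (hN : 1 ≤ N) :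
    |((∑ d ∈ Icc 1 (2 * N), μ d *
        ∑ g ∈ Icc 1 (2 * N), ∑ k ∈ Icc 1 (2 * N), corr N (d * g) (d * k) : ℤ) : ℝ) -
      (2 * N : ℝ) ^ 5 * ((∑ d ∈ Icc 1 (2 * N), (μ d : ℝ) / (d : ℝ) ^ 3) *
        ∑ m ∈ Icc 1 (2 * N), (5 / 3 * (1 / (m : ℝ) ^ 2) - 1 / (m : ℝ) ^ 3))| ≤
      480 * (2 * N : ℝ) ^ 4 * (1 + Real.log (2 * N)) := by
  have hlog : 0 ≤ Real.log (2 * N) := Real.log_nonneg (by norm_cast; omega)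
  rw [sum_mul, mul_sum, Int.cast_sum, ← sum_sub_distrib]
  calc _ ≤ ∑ d ∈ Icc 1 (2 * N),
        240 * (2 * N : ℝ) ^ 4 * (1 + Real.log (2 * N)) * (1 / (d : ℝ) ^ 2) := by
        refine (abs_sum_le_sum_abs _ _).trans (sum_le_sum fun d hd => ?_)
        have h := sum_corr_estimate hN (mem_Icc.1 hd).1 (2 * N)
        have hmu : |(μ d : ℝ)| ≤ 1 := by
          exact_mod_cast ArithmeticFunction.abs_moebius_le_one (n := d)
        rw [Nat.cast_mul 2 N, Nat.cast_ofNat] at h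
        refine le_trans (le_of_eq ?_) ((mul_le_of_le_one_left (abs_nonneg _) hmu).trans h)
        rw [← abs_mul, Int.cast_mul]
        congr 1
        ring
    _ = 240 * (2 * N : ℝ) ^ 4 * (1 + Real.log (2 * N)) *
        ∑ d ∈ Icc 1 (2 * N), 1 / (d : ℝ) ^ 2 := by rw [mul_sum]
    _ ≤ 240 * (2 * N : ℝ) ^ 4 * (1 + Real.log (2 * N)) * 2 := by
        gcongr; exact sum_inv_sq_le_two (by omega)
    _ = _ := by ring

lemma abs_sum_moebius_sub_le {M : ℕ} (hM : 1 ≤ M) :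
    |∑ d ∈ Icc 1 M, (μ d : ℝ) / (d : ℝ) ^ 3 - 1 / zetaNat 3| ≤ 1 / M := by
  refine abs_sum_Icc_sub_le (f := fun n => (μ n : ℝ) / (n : ℝ) ^ 3)
    hasSum_moebius_div_cube (fun n hn => ?_) hM
  have hn' : (1 : ℝ) ≤ n := by exact_mod_cast hn
  have hmu : |(μ n : ℝ)| ≤ 1 := by
    exact_mod_cast ArithmeticFunction.abs_moebius_le_one (n := n)
  rw [abs_div, abs_of_pos (by positivity : (0 : ℝ) < (n : ℝ) ^ 3)]
  gcongr
  norm_num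

lemma abs_sum_inv_pow_sub_le {M : ℕ} (hM : 1 ≤ M) :
    |∑ m ∈ Icc 1 M, (5 / 3 * (1 / (m : ℝ) ^ 2) - 1 / (m : ℝ) ^ 3) -
      (5 / 3 * zetaNat 2 - zetaNat 3)| ≤ 3 / M := by
  refine abs_sum_Icc_sub_le ?_ (fun n hn => ?_) hM
  · push_cast
    exact ((hasSum_zetaNat (by norm_num)).mul_left _).sub (hasSum_zetaNat (by norm_num))
  have hn' : (1 : ℝ) ≤ n := by exact_mod_cast hn
  have h1 : 1 / (n : ℝ) ^ 3 ≤ 1 / (n : ℝ) ^ 2 := by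
    gcongr
    norm_num
  have h2 : 0 ≤ 1 / (n : ℝ) ^ 3 := by positivity
  have h3 : 3 / (n : ℝ) ^ 2 = 3 * (1 / (n : ℝ) ^ 2) := by ring
  rw [h3, abs_le]
  constructor <;> linarith

lemma matCommCount_two_estimate {N : ℕ} (hN : 1 ≤ N) :
    |(matCommCount 2 N : ℝ) - (10 * zetaNat 2 / (3 * zetaNat 3)) * (2 * (N : ℝ)) ^ 5| ≤
      (62 + 2 * (3 * (|1 / zetaNat 3| + 1) + |5 / 3 * zetaNat 2 - zetaNat 3|)) *
        (2 * (N : ℝ)) ^ 4 + 960 * (2 * (N : ℝ)) ^ 4 * (1 + Real.log (2 * N)) := by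
  have hc := congrArg (Int.cast : ℤ → ℝ) ((matCommCount_two N).trans (sum_parallel N))
  rw [sum_wt] at hc
  have hS := sum_moebius_corr_estimate hN
  have hA := abs_sum_moebius_sub_le (M := 2 * N) (by omega)
  have hB := abs_sum_inv_pow_sub_le (M := 2 * N) (by omega)
  have hK : 10 * zetaNat 2 / (3 * zetaNat 3) =
      2 + 2 * (1 / zetaNat 3 * (5 / 3 * zetaNat 2 - zetaNat 3)) := by
    have := zetaNat_three_pos.ne'
    field_simp
    ring
  rw [hK]
  generalize (1 / zetaNat 3) = α at *
  generalize 5 / 3 * zetaNat 2 - zetaNat 3 = β at *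
  generalize ∑ d ∈ Icc 1 (2 * N), μ d *
    ∑ g ∈ Icc 1 (2 * N), ∑ k ∈ Icc 1 (2 * N), corr N (d * g) (d * k) = S at *
  generalize ∑ d ∈ Icc 1 (2 * N), (μ d : ℝ) / (d : ℝ) ^ 3 = A at *
  generalize ∑ m ∈ Icc 1 (2 * N), (5 / 3 * (1 / (m : ℝ) ^ 2) - 1 / (m : ℝ) ^ 3) = B at *
  push_cast at hc hA hB
  rw [hc]
  have hM : (1 : ℝ) ≤ 2 * N := by norm_cast; omega
  generalize Real.log (2 * N) = l at *
  generalize (2 * (N : ℝ)) = M at *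
  have hM0 : 0 < M := by linarith
  have hA' : |A| ≤ |α| + 1 := by
    have h1 : 1 / M ≤ 1 := (div_le_one hM0).2 hM
    have h2 := abs_sub_abs_le_abs_sub A α
    linarith
  have hAB : |A * B - α * β| ≤ (3 * (|α| + 1) + |β|) / M := by
    have e : A * B - α * β = A * (B - β) + (A - α) * β := by ring
    rw [e]
    calc _ ≤ |A * (B - β)| + |(A - α) * β| := abs_add_le _ _
      _ ≤ (|α| + 1) * (3 / M) + 1 / M * |β| := by
        rw [abs_mul, abs_mul]; gcongr
      _ = _ := by ring
  have hAB' : |M ^ 5 * (A * B - α * β)| ≤ M ^ 4 * (3 * (|α| + 1) + |β|) := by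
    rw [abs_mul, abs_of_pos (by positivity)]
    calc _ ≤ M ^ 5 * ((3 * (|α| + 1) + |β|) / M) := by gcongr
      _ = _ := by field_simp
  have hL : |2 * (M + 1) * (M + 1) ^ 4 - (M + 1) ^ 2 - 2 * M ^ 5| ≤ 62 * M ^ 4 := by
    have p1 : M ^ 3 ≤ M ^ 4 := pow_le_pow_right₀ hM (by norm_num)
    have p2 : M ^ 2 ≤ M ^ 4 := pow_le_pow_right₀ hM (by norm_num)
    have p3 : M ≤ M ^ 4 := le_self_pow₀ hM (by norm_num)
    have p4 : 1 ≤ M ^ 4 := one_le_pow₀ hM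
    rw [abs_le]
    constructor <;> nlinarith
  have e : 2 * (M + 1) * (M + 1) ^ 4 - (M + 1) ^ 2 + 2 * (S : ℝ) - (2 + 2 * (α * β)) * M ^ 5 =
      (2 * (M + 1) * (M + 1) ^ 4 - (M + 1) ^ 2 - 2 * M ^ 5) +
      2 * (S - M ^ 5 * (A * B)) + 2 * (M ^ 5 * (A * B - α * β)) := by ring
  rw [e]
  rw [abs_le] at hL hS hAB' ⊢
  constructor <;> linarith

end CommutingMatrices

theorem commuting_2x2_asymptotic :
    ∃ C : ℝ, 0 < C ∧ ∀ N : ℕ, 1 < N →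
      |(matCommCount 2 N : ℝ) -
        (10 * zetaNat 2 / (3 * zetaNat 3)) * (2 * (N : ℝ)) ^ 5| ≤
      C * (N : ℝ) ^ 4 * Real.log N := by
  refine ⟨32 * (62 + 2 * (3 * (|1 / zetaNat 3| + 1) + |5 / 3 * zetaNat 2 - zetaNat 3|)) +
    16 * 960 * 4, by positivity, fun N hN => (CommutingMatrices.matCommCount_two_estimate hN.le).trans ?_⟩
  have hN2 : (2 : ℝ) ≤ N := by exact_mod_cast hN
  have hl : Real.log 2 ≤ Real.log N := Real.log_le_log (by norm_num) hN2
  have hl2 := Real.log_two_gt_d9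
  have h1 : 1 ≤ 2 * Real.log N := by linarith
  have h2 : 1 + Real.log (2 * N) ≤ 4 * Real.log N := by
    rw [Real.log_mul (by norm_num) (by positivity)]
    linarith
  have hD : 0 ≤ 62 + 2 * (3 * (|1 / zetaNat 3| + 1) + |5 / 3 * zetaNat 2 - zetaNat 3|) := by
    positivity
  generalize 62 + 2 * (3 * (|1 / zetaNat 3| + 1) + |5 / 3 * zetaNat 2 - zetaNat 3|) = D at *
  calc _ ≤ D * (2 * (N : ℝ)) ^ 4 * (2 * Real.log N) +
        960 * (2 * (N : ℝ)) ^ 4 * (4 * Real.log N) := by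
        exact add_le_add (le_mul_of_one_le_right (by positivity) h1) (by gcongr)
    _ = _ := by ring
end

section
/- For any prime p and positive integer n, one has 𝔠₂(ℤ/pⁿℤ)/p^{6n} = (1 + 1/p)·(1 − 1/p²)^{-1}·(1 − 1/p³)·(1 − 1/p^{2⌈n/2⌉}) + O(n²·p^{-n/2}), with an absolute implied constant. -/
/-- The number of pairs `(A,B)` of `2 × 2` matrices over `ZMod q` such that
`A * B = B * A`. -/
noncomputable def matCommCountZMod (q : ℕ) : ℕ :=
  Nat.card {AB : Matrix (Fin 2) (Fin 2) (ZMod q) × Matrix (Fin 2) (Fin 2) (ZMod q) //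
    AB.1 * AB.2 = AB.2 * AB.1}

/-- Two triples over a commutative ring are parallel when all the `2 × 2` minors they form vanish. -/
def IsParallelTriple {R : Type*} [CommRing R] (u v : Fin 3 → R) : Prop :=
  ∀ i j, u i * v j = u j * v i

/-- The number of ordered pairs of parallel triples. -/
noncomputable def parallelPairCount (R : Type*) [CommRing R] : ℕ :=
  Nat.card {uv : (Fin 3 → R) × (Fin 3 → R) // IsParallelTriple uv.1 uv.2}

/-- A `2 × 2` matrix is given by a scalar part and a triple measuring its failure to be scalar. -/
def matrixEquivScalarTriple (R : Type*) [CommRing R] :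
    Matrix (Fin 2) (Fin 2) R ≃ R × (Fin 3 → R) where
  toFun A := (A 1 1, ![A 0 0 - A 1 1, A 0 1, A 1 0])
  invFun x := !![x.2 0 + x.1, x.2 1; x.2 2, x.1]
  left_inv A := by ext i j; fin_cases i <;> fin_cases j <;> simp
  right_inv x := by
    refine Prod.ext (by simp) ?_
    funext i
    fin_cases i <;> simp

lemma mul_comm_iff_isParallelTriple {R : Type*} [CommRing R] (A B : Matrix (Fin 2) (Fin 2) R) :
    A * B = B * A ↔
      IsParallelTriple (matrixEquivScalarTriple R A).2 (matrixEquivScalarTriple R B).2 := by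
  have h1 : A * B = B * A ↔ (A 0 1 * B 1 0 = B 0 1 * A 1 0) ∧
      (A 0 0 - A 1 1) * B 0 1 = A 0 1 * (B 0 0 - B 1 1) ∧
      (A 0 0 - A 1 1) * B 1 0 = A 1 0 * (B 0 0 - B 1 1) := by
    constructor
    · intro h
      have h00 := congrFun (congrFun h 0) 0
      have h01 := congrFun (congrFun h 0) 1
      have h10 := congrFun (congrFun h 1) 0
      simp only [Matrix.mul_apply, Fin.sum_univ_two] at h00 h01 h10
      refine ⟨?_, ?_, ?_⟩
      · linear_combination h00
      · linear_combination h01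
      · linear_combination -h10
    · rintro ⟨h0, h1, h2⟩
      ext i j
      fin_cases i <;> fin_cases j <;> simp only [Matrix.mul_apply, Fin.sum_univ_two,
        Fin.zero_eta, Fin.mk_one]
      · linear_combination h0
      · linear_combination h1
      · linear_combination -h2
      · linear_combination -h0
  rw [h1]
  simp only [IsParallelTriple, matrixEquivScalarTriple, Equiv.coe_fn_mk, Fin.forall_fin_succ,
    Fin.isValue]
  simp
  grind

lemma matCommCountZMod_eq (q : ℕ) :
    matCommCountZMod q = q ^ 2 * parallelPairCount (ZMod q) := by
  have e : {AB : Matrix (Fin 2) (Fin 2) (ZMod q) × Matrix (Fin 2) (Fin 2) (ZMod q) //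
      AB.1 * AB.2 = AB.2 * AB.1} ≃ (ZMod q × ZMod q) ×
      {uv : (Fin 3 → ZMod q) × (Fin 3 → ZMod q) // IsParallelTriple uv.1 uv.2} :=
    { toFun := fun x => ((((matrixEquivScalarTriple _) x.1.1).1,
          ((matrixEquivScalarTriple _) x.1.2).1),
        ⟨(((matrixEquivScalarTriple _) x.1.1).2, ((matrixEquivScalarTriple _) x.1.2).2),
          (mul_comm_iff_isParallelTriple _ _).1 x.2⟩)
      invFun := fun y => ⟨((matrixEquivScalarTriple _).symm (y.1.1, y.2.1.1),
        (matrixEquivScalarTriple _).symm (y.1.2, y.2.1.2)), by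
          rw [mul_comm_iff_isParallelTriple]
          simpa using y.2.2⟩
      left_inv := fun x => by simp
      right_inv := fun y => by simp }
  rw [matCommCountZMod, Nat.card_congr e, Nat.card_prod, Nat.card_prod, Nat.card_zmod,
    parallelPairCount, sq]

lemma card_isParallelTriple_of_isUnit {R : Type*} [CommRing R] (u : Fin 3 → R)
    (hu : ∃ i, IsUnit (u i)) : Nat.card {v // IsParallelTriple u v} = Nat.card R := by
  obtain ⟨i, c, hc⟩ := hu
  refine (Nat.card_congr (Equiv.ofBijective
    (fun r : R => (⟨fun j => r * u j, fun a b => by ring⟩ : {v // IsParallelTriple u v}))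
    ⟨fun r s h => ?_, fun v => ⟨v.1 i * ↑c⁻¹, ?_⟩⟩)).symm
  · have h1 : r * u i = s * u i := congrFun (Subtype.ext_iff.1 h) i
    rw [← hc] at h1
    exact c.isUnit.mul_right_cancel h1
  · refine Subtype.ext (funext fun j => ?_)
    have h1 := v.2 i j
    have h2 : (↑c⁻¹ : R) * u i = 1 := by rw [← hc]; simp
    change v.1 i * ↑c⁻¹ * u j = v.1 j
    linear_combination (v.1 j) * h2 - (↑c⁻¹ : R) * h1

lemma parallelPairCount_eq_sum (R : Type*) [CommRing R] [Fintype R] :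
    parallelPairCount R = ∑ u : Fin 3 → R, Nat.card {v // IsParallelTriple u v} := by
  rw [parallelPairCount, ← Nat.card_sigma]
  exact Nat.card_congr (Equiv.subtypeProdEquivSigmaSubtype fun u v => IsParallelTriple u v)

/-- Counting preimages under a surjective homomorphism of finite groups. -/
lemma card_preimage_mul_card {G H : Type*} [AddGroup G] [AddGroup H] [Finite G] [Finite H]
    (f : G →+ H) (hf : Function.Surjective f) (P : H → Prop) :
    Nat.card {g // P (f g)} * Nat.card H = Nat.card G * Nat.card {h // P h} := by
  have key : ∀ Q : H → Prop,
      Nat.card {g // Q (f g)} = Nat.card {h // Q h} * Nat.card f.ker := by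
    intro Q
    rw [← Nat.card_prod]
    choose s hs using hf
    refine Nat.card_congr
      { toFun := fun g => (⟨f g.1, g.2⟩, ⟨-s (f g.1) + g.1, by simp [AddMonoidHom.mem_ker, hs]⟩)
        invFun := fun x => ⟨s x.1.1 + x.2.1, ?_⟩
        left_inv := fun g => by simp
        right_inv := fun x => ?_ }
    · have := AddMonoidHom.mem_ker.1 x.2.2
      simpa [hs, this] using x.1.2
    · have := AddMonoidHom.mem_ker.1 x.2.2
      ext <;> simp [hs, this]
  have h1 := key fun _ => True
  rw [Nat.card_congr (Equiv.subtypeUnivEquiv fun _ => trivial),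
    Nat.card_congr (Equiv.subtypeUnivEquiv fun _ => trivial)] at h1
  rw [key P, h1]
  ring

section PrimePower

variable (p n : ℕ)

/-- Reduction modulo `p ^ n`. -/
def reducePrimePow : ZMod (p ^ (n + 1)) →+* ZMod (p ^ n) :=
  ZMod.castHom (pow_dvd_pow p n.le_succ) _

lemma reducePrimePow_surjective : Function.Surjective (reducePrimePow p n) :=
  ZMod.castHom_surjective _

variable [Fact p.Prime]

lemma reducePrimePow_eq_iff (a b : ZMod (p ^ (n + 1))) :
    reducePrimePow p n a = reducePrimePow p n b ↔ (p : ZMod (p ^ (n + 1))) * a = p * b := by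
  have hp : (p : ℤ) ≠ 0 := by exact_mod_cast (Fact.out : p.Prime).ne_zero
  obtain ⟨x, rfl⟩ := ZMod.intCast_surjective a
  obtain ⟨y, rfl⟩ := ZMod.intCast_surjective b
  rw [map_intCast, map_intCast]
  have h : ((p : ZMod (p ^ (n + 1))) * (x : ZMod (p ^ (n + 1))) = p * (y : ZMod (p ^ (n + 1)))) ↔
      (((p * x : ℤ) : ZMod (p ^ (n + 1))) = ((p * y : ℤ) : ZMod (p ^ (n + 1)))) := by
    push_cast
    rfl
  rw [h, ZMod.intCast_eq_intCast_iff_dvd_sub, ZMod.intCast_eq_intCast_iff_dvd_sub, ← mul_sub]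
  push_cast
  rw [pow_succ', mul_dvd_mul_iff_left hp]

/-- The embedding `ZMod (p ^ n) → ZMod (p ^ (n + 1))` induced by multiplication by `p`. -/
noncomputable def mulPrime (x : ZMod (p ^ n)) : ZMod (p ^ (n + 1)) :=
  p * (reducePrimePow_surjective p n x).choose

lemma mulPrime_reducePrimePow (a : ZMod (p ^ (n + 1))) :
    mulPrime p n (reducePrimePow p n a) = p * a :=
  (reducePrimePow_eq_iff p n _ _).1 (reducePrimePow_surjective p n _).choose_spec

lemma mulPrime_injective : Function.Injective (mulPrime p n) := by
  intro x y h
  obtain ⟨a, rfl⟩ := reducePrimePow_surjective p n x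
  obtain ⟨b, rfl⟩ := reducePrimePow_surjective p n y
  rw [mulPrime_reducePrimePow, mulPrime_reducePrimePow] at h
  exact (reducePrimePow_eq_iff p n _ _).2 h

lemma mulPrime_mul_eq_iff (x y : ZMod (p ^ n)) (a b : ZMod (p ^ (n + 1))) :
    mulPrime p n x * a = mulPrime p n y * b ↔
      x * reducePrimePow p n a = y * reducePrimePow p n b := by
  obtain ⟨x, rfl⟩ := reducePrimePow_surjective p n x
  obtain ⟨y, rfl⟩ := reducePrimePow_surjective p n y
  rw [mulPrime_reducePrimePow, mulPrime_reducePrimePow, ← map_mul, ← map_mul,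
    reducePrimePow_eq_iff, mul_assoc, mul_assoc]

lemma not_isUnit_iff_mem_range_mulPrime (a : ZMod (p ^ (n + 1))) :
    ¬ IsUnit a ↔ ∃ x, mulPrime p n x = a := by
  have hp : p.Prime := Fact.out
  have hu : ∀ m : ℕ, IsUnit (m : ZMod (p ^ (n + 1))) ↔ ¬ p ∣ m := fun m => by
    rw [ZMod.isUnit_iff_coprime, Nat.coprime_pow_right_iff n.succ_pos, Nat.coprime_comm,
      hp.coprime_iff_not_dvd]
  constructor
  · intro h
    obtain ⟨m, rfl⟩ := ZMod.natCast_zmod_surjective a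
    rw [hu, not_not] at h
    obtain ⟨k, rfl⟩ := h
    exact ⟨reducePrimePow p n k, by rw [mulPrime_reducePrimePow]; push_cast; rfl⟩
  · rintro ⟨x, rfl⟩ h
    exact (hu p).1 (isUnit_of_mul_isUnit_left h) dvd_rfl

lemma card_isParallelTriple_mulPrime (w : Fin 3 → ZMod (p ^ n)) :
    Nat.card {v // IsParallelTriple (fun i => mulPrime p n (w i)) v} =
      p ^ 3 * Nat.card {v // IsParallelTriple w v} := by
  have h := card_preimage_mul_card ((reducePrimePow p n).toAddMonoidHom.compLeft (Fin 3))
    (reducePrimePow_surjective p n).comp_left (IsParallelTriple w)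
  have hc : ∀ m, Nat.card (Fin 3 → ZMod (p ^ m)) = (p ^ m) ^ 3 := fun m => by simp
  rw [hc, hc] at h
  have h0 : 0 < (p ^ n) ^ 3 := pow_pos (pow_pos (Fact.out : p.Prime).pos _) _
  have e : Nat.card {v // IsParallelTriple (fun i => mulPrime p n (w i)) v} =
      Nat.card {v // IsParallelTriple w
        ((reducePrimePow p n).toAddMonoidHom.compLeft (Fin 3) v)} :=
    Nat.card_congr (Equiv.subtypeEquivRight fun v =>
      forall₂_congr fun i j => mulPrime_mul_eq_iff p n (w i) (w j) (v j) (v i))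
  rw [e]
  refine Nat.eq_of_mul_eq_mul_right h0 (h.trans ?_)
  ring

lemma parallelPairCount_succ :
    parallelPairCount (ZMod (p ^ (n + 1))) + p ^ (3 * n) * p ^ (n + 1) =
      p ^ (3 * (n + 1)) * p ^ (n + 1) + p ^ 3 * parallelPairCount (ZMod (p ^ n)) := by
  classical
  have hinj : Function.Injective
      fun (w : Fin 3 → ZMod (p ^ n)) i => mulPrime p n (w i) :=
    (mulPrime_injective p n).comp_left
  have himg : Finset.univ.filter (fun u : Fin 3 → ZMod (p ^ (n + 1)) => ¬ ∃ i, IsUnit (u i)) =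
      Finset.univ.image fun (w : Fin 3 → ZMod (p ^ n)) i => mulPrime p n (w i) := by
    ext u
    simp only [Finset.mem_filter, Finset.mem_univ, true_and, Finset.mem_image, not_exists,
      not_isUnit_iff_mem_range_mulPrime]
    constructor
    · intro h
      choose w hw using h
      exact ⟨w, funext hw⟩
    · rintro ⟨w, rfl⟩ i
      exact ⟨w i, rfl⟩
  have hcard := Finset.card_filter_add_card_filter_not
    (s := (Finset.univ : Finset (Fin 3 → ZMod (p ^ (n + 1))))) (fun u => ∃ i, IsUnit (u i))
  rw [himg, Finset.card_image_of_injective _ hinj] at hcard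
  simp only [Finset.card_univ, Fintype.card_fun, ZMod.card, Fintype.card_fin] at hcard
  rw [parallelPairCount_eq_sum, parallelPairCount_eq_sum,
    ← Finset.sum_filter_add_sum_filter_not Finset.univ
      (fun u : Fin 3 → ZMod (p ^ (n + 1)) => ∃ i, IsUnit (u i)), himg,
    Finset.sum_image hinj.injOn,
    Finset.sum_congr rfl fun u hu =>
      card_isParallelTriple_of_isUnit u (Finset.mem_filter.1 hu).2,
    Finset.sum_congr rfl fun w _ => card_isParallelTriple_mulPrime p n w,
    Finset.sum_const, smul_eq_mul, Nat.card_zmod, ← Finset.mul_sum, mul_comm 3, mul_comm 3,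
    pow_mul, pow_mul, ← hcard]
  ring

lemma parallelPairCount_zmod_pow :
    (p : ℝ) ^ 2 * (p - 1) * parallelPairCount (ZMod (p ^ n)) =
      p ^ 2 * (p - 1) * p ^ (3 * n) + (p ^ 3 - 1) * p ^ (3 * n) * (p ^ n - 1) := by
  induction n with
  | zero =>
    have : Subsingleton (ZMod (p ^ 0)) := by rw [pow_zero]; infer_instance
    have h : parallelPairCount (ZMod (p ^ 0)) = 1 := by
      rw [parallelPairCount, Nat.card_eq_one_iff_unique]
      exact ⟨inferInstance, ⟨⟨(0, 0), fun _ _ => Subsingleton.elim _ _⟩⟩⟩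
    rw [h]
    simp
  | succ n ih =>
    have h : ((parallelPairCount (ZMod (p ^ (n + 1))) : ℝ)) + p ^ (3 * n) * p ^ (n + 1) =
        p ^ (3 * (n + 1)) * p ^ (n + 1) + p ^ 3 * parallelPairCount (ZMod (p ^ n)) := by
      exact_mod_cast parallelPairCount_succ p n
    linear_combination (p : ℝ) ^ 2 * (p - 1) * h + (p : ℝ) ^ 3 * ih

end PrimePower

theorem commuting_2x2_mod_p_pow :
    ∃ C : ℝ, 0 < C ∧ ∀ p n : ℕ, p.Prime → 0 < n →
      |(matCommCountZMod (p ^ n) : ℝ) / (p : ℝ) ^ (6 * n) -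
        (1 + 1 / (p : ℝ)) * (1 - 1 / (p : ℝ) ^ 2)⁻¹ * (1 - 1 / (p : ℝ) ^ 3) *
          (1 - 1 / (p : ℝ) ^ (2 * ((n + 1) / 2)))| ≤
      C * (n : ℝ) ^ 2 * (p : ℝ) ^ (-(n : ℝ) / 2) := by
  refine ⟨1, one_pos, fun p n hp hn => ?_⟩
  have : Fact p.Prime := ⟨hp⟩
  have hp2 : (2 : ℝ) ≤ p := by exact_mod_cast hp.two_le
  have hp0 : (p : ℝ) ≠ 0 := by positivity
  have hp1 : (p : ℝ) - 1 ≠ 0 := by linarith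
  have hpp : (p : ℝ) + 1 ≠ 0 := by linarith
  have hsq : (p : ℝ) ^ 2 - 1 ≠ 0 := by
    rw [show (p : ℝ) ^ 2 - 1 = (p - 1) * (p + 1) by ring]
    exact mul_ne_zero hp1 hpp
  set c : ℝ := (p ^ 3 - 1) / (p ^ 2 * (p - 1)) with hc
  have hc0 : 0 ≤ c := div_nonneg (by nlinarith [sq_nonneg (p : ℝ)])
    (mul_nonneg (by positivity) (by linarith))
  have hc2 : c ≤ 2 := by
    rw [hc, div_le_iff₀ (mul_pos (by positivity) (by linarith))]
    nlinarith [sq_nonneg (p : ℝ), mul_nonneg (sq_nonneg (p : ℝ)) (sub_nonneg.2 hp2)]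
  have hmain : (1 + 1 / (p : ℝ)) * (1 - 1 / (p : ℝ) ^ 2)⁻¹ * (1 - 1 / (p : ℝ) ^ 3) = c := by
    rw [hc]
    field_simp
    ring
  have hcount : (matCommCountZMod (p ^ n) : ℝ) / (p : ℝ) ^ (6 * n) =
      1 / p ^ n + c * (1 - 1 / p ^ n) := by
    have hN : (parallelPairCount (ZMod (p ^ n)) : ℝ) =
        p ^ (3 * n) + c * p ^ (3 * n) * (p ^ n - 1) := by
      refine mul_left_cancel₀ (mul_ne_zero (pow_ne_zero 2 hp0) hp1) ?_
      rw [parallelPairCount_zmod_pow, hc]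
      field_simp
    rw [matCommCountZMod_eq]
    push_cast
    rw [hN, pow_mul' _ 3, pow_mul' _ 6]
    have hn0 : (p : ℝ) ^ n ≠ 0 := pow_ne_zero _ hp0
    generalize (p : ℝ) ^ n = q at hn0
    field_simp
  rw [hmain, hcount]
  have hp1' : (1 : ℝ) ≤ p := by linarith
  have hr : (1 : ℝ) / p ^ (2 * ((n + 1) / 2)) ≤ 1 / p ^ n :=
    one_div_le_one_div_of_le (by positivity) (pow_le_pow_right₀ hp1' (by omega))
  have hr0 : (0 : ℝ) ≤ 1 / p ^ (2 * ((n + 1) / 2)) := by positivity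
  have hs0 : (0 : ℝ) ≤ 1 / p ^ n := by positivity
  have hexp : (1 : ℝ) / p ^ n ≤ (p : ℝ) ^ (-(n : ℝ) / 2) := by
    rw [one_div, ← Real.rpow_natCast, ← Real.rpow_neg (by linarith)]
    exact Real.rpow_le_rpow_of_exponent_le hp1' (by linarith [(n.cast_nonneg : (0 : ℝ) ≤ n)])
  have hn1 : (1 : ℝ) ≤ (n : ℝ) ^ 2 := one_le_pow₀ (by exact_mod_cast hn)
  have habs : |1 / (p : ℝ) ^ n + c * (1 - 1 / p ^ n) - c * (1 - 1 / p ^ (2 * ((n + 1) / 2)))| ≤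
      1 / p ^ n := by
    generalize (1 : ℝ) / p ^ (2 * ((n + 1) / 2)) = r at *
    generalize (1 : ℝ) / p ^ n = s at *
    rw [abs_le]
    constructor <;> nlinarith
  rw [one_mul]
  exact habs.trans (hexp.trans (le_mul_of_one_le_left (by positivity) hn1))
end

section
/- There exists an absolute constant C > 0 such that for every positive integer N and every integer h with 0 < |h| ≤ 2N², one has r_N(h) ≤ C·N²·∑_{d | h, 1 ≤ d ≤ N} 1/d, where the sum is over positive divisors d of h with d ≤ N. -/
/-- `rN N h` is the number of quadruples `(a₁,a₂,a₃,a₄)` of integers with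
`|aᵢ| ≤ N` and `a₁a₂ - a₃a₄ = h`. -/
noncomputable def rN (N : ℕ) (h : ℤ) : ℕ :=
  Nat.card {a : ℤ × ℤ × ℤ × ℤ //
    |a.1| ≤ (N : ℤ) ∧ |a.2.1| ≤ (N : ℤ) ∧ |a.2.2.1| ≤ (N : ℤ) ∧ |a.2.2.2| ≤ (N : ℤ) ∧
    a.1 * a.2.1 - a.2.2.1 * a.2.2.2 = h}

open Finset in
/-- A line `p x - q y = c` with `p ≠ 0` and `p, q` coprime has few integer points in a box. -/
theorem card_line_box_le {p q : ℤ} (hpq : IsCoprime p q) (hp : p ≠ 0) (c : ℤ) (N : ℕ) :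
    #{v ∈ Icc (-(N : ℤ)) N ×ˢ Icc (-(N : ℤ)) N | p * v.1 - q * v.2 = c} ≤
      2 * (N / p.natAbs) + 2 := by
  have hp' : (0 : ℤ) < p.natAbs := by omega
  have hcard : #(Icc (-((N / p.natAbs : ℕ) : ℤ) - 1) ((N / p.natAbs : ℕ) : ℤ)) =
      2 * (N / p.natAbs) + 2 := by
    rw [Int.card_Icc]; omega
  rw [← hcard]
  refine card_le_card_of_injOn (fun v => v.2 / (p.natAbs : ℤ)) ?_ ?_
  · rintro ⟨x, y⟩ hv
    simp only [coe_filter, mem_product, mem_Icc, Set.mem_ofPred_eq] at hv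
    obtain ⟨⟨-, hy₁, hy₂⟩, -⟩ := hv
    simp only [coe_Icc, Set.mem_Icc, Int.natCast_div]
    constructor
    · rw [Int.le_ediv_iff_mul_le hp']
      have h₁ := Int.lt_ediv_add_one_mul_self (N : ℤ) hp'
      linarith
    · exact Int.ediv_le_ediv hp' hy₂
  · rintro ⟨x, y⟩ hv ⟨x', y'⟩ hv' hdiv
    simp only [coe_filter, Set.mem_ofPred_eq] at hv hv' hdiv
    have hdvd : p ∣ y - y' := by
      refine hpq.dvd_of_dvd_mul_left ⟨x - x', ?_⟩
      linarith [hv.2, hv'.2]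
    have hmod : y % (p.natAbs : ℤ) = y' % (p.natAbs : ℤ) :=
      Int.emod_eq_emod_iff_emod_sub_eq_zero.2 (Int.emod_eq_zero_of_dvd (Int.natAbs_dvd.2 hdvd))
    have hy : y = y' := by
      rw [← Int.mul_ediv_add_emod y p.natAbs, ← Int.mul_ediv_add_emod y' p.natAbs, hdiv, hmod]
    subst hy
    have hx : x = x' := mul_left_cancel₀ hp (by linarith [hv.2, hv'.2])
    rw [hx]

open Finset in
/-- The bound of `card_line_box_le` in terms of the larger of the two coefficients. -/
theorem mul_card_line_box_le {p q : ℤ} (hpq : IsCoprime p q) {m : ℕ} (hm : 0 < m)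
    (hmax : max p.natAbs q.natAbs = m) (c : ℤ) {N : ℕ} (hmN : m ≤ N) :
    m * #{v ∈ Icc (-(N : ℤ)) N ×ˢ Icc (-(N : ℤ)) N | p * v.1 - q * v.2 = c} ≤ 4 * N := by
  have key : #{v ∈ Icc (-(N : ℤ)) N ×ˢ Icc (-(N : ℤ)) N | p * v.1 - q * v.2 = c} ≤
      2 * (N / m) + 2 := by
    rcases max_choice p.natAbs q.natAbs with h | h
    · have hp : p.natAbs = m := h.symm.trans hmax
      simpa only [hp] using card_line_box_le hpq (by omega) c N
    · have hq : q.natAbs = m := h.symm.trans hmax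
      refine le_trans (card_le_card_of_injOn Prod.swap ?_ Prod.swap_injective.injOn)
        (by simpa only [hq] using card_line_box_le hpq.symm (by omega) (-c) N)
      rintro ⟨x, y⟩ hv
      simp only [coe_filter, mem_product, Set.mem_ofPred_eq, Prod.swap] at hv ⊢
      exact ⟨hv.1.symm, by linarith [hv.2]⟩
  calc _ ≤ m * (2 * (N / m) + 2) := Nat.mul_le_mul_left m key
    _ = 2 * (m * (N / m)) + 2 * m := by ring
    _ ≤ 4 * N := by have := Nat.mul_div_le N m; omega

open Finset in
/-- Solutions of `a₁a₂ - a₃a₄ = h` in the box, sorted by `d = gcd(a₁, a₃)` and by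
`(a₁, a₃) / d`. -/
theorem rN_le_sum (N : ℕ) {h : ℤ} (hh : h ≠ 0) :
    rN N h ≤ ∑ d ∈ h.natAbs.divisors with d ≤ N, ∑ m ∈ Icc 1 (N / d),
      ∑ p ∈ (box m : Finset (ℤ × ℤ)) with IsCoprime p.1 p.2,
        #{v ∈ Icc (-(N : ℤ)) N ×ˢ Icc (-(N : ℤ)) N | p.1 * v.1 - p.2 * v.2 = h / d} := by
  simp_rw [← card_sigma]
  refine le_trans ?_ (card_image_le
    (f := fun t => ((t.1 : ℤ) * t.2.2.1.1, t.2.2.2.1, (t.1 : ℤ) * t.2.2.1.2, t.2.2.2.2)))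
  rw [← Set.ncard_coe_finset]
  refine Set.ncard_le_ncard ?_ (finite_toSet _)
  rintro ⟨a, x, b, y⟩ ⟨ha, hx, hb, hy, heq⟩
  dsimp only at ha hx hb hy heq
  have hg : 0 < Int.gcd a b := by
    refine Int.gcd_pos_iff.2 ?_
    by_contra! h₀
    exact hh (by rw [← heq, h₀.1, h₀.2]; ring)
  obtain ⟨p, q, hpq, hp, hq⟩ := Int.exists_gcd_one hg
  generalize Int.gcd a b = d at hg hp hq
  subst hp hq
  have hd : (d : ℤ) ≠ 0 := by omega
  have hline : h = d * (p * x - q * y) := by linarith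
  have hmax : d * max p.natAbs q.natAbs ≤ N := by
    rw [Int.abs_eq_natAbs, Int.natAbs_mul, Int.natAbs_natCast, Nat.cast_le, mul_comm] at ha hb
    rcases max_choice p.natAbs q.natAbs with h₁ | h₁ <;> rwa [h₁]
  have hpos : 0 < max p.natAbs q.natAbs := by
    by_contra h₀
    have : p = 0 ∧ q = 0 := by omega
    simp [this] at hpq
  rw [mem_coe, mem_image]
  refine ⟨⟨d, max p.natAbs q.natAbs, (p, q), (x, y)⟩, ?_, ?_⟩
  · simp only [mem_sigma, mem_filter, mem_product, mem_Icc, Int.mem_box, Nat.mem_divisors]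
    refine ⟨⟨⟨?_, by omega⟩, ?_⟩, ⟨hpos, ?_⟩, ⟨trivial, Int.isCoprime_iff_gcd_eq_one.2 hpq⟩,
      ⟨abs_le.1 hx, abs_le.1 hy⟩, ?_⟩
    · exact Int.natCast_dvd.1 ⟨_, hline⟩
    · exact (Nat.le_mul_of_pos_right d hpos).trans hmax
    · exact (Nat.le_div_iff_mul_le hg).2 (by rwa [mul_comm])
    · rw [hline, Int.mul_ediv_cancel_left _ hd]
  · simp only [mul_comm]

theorem restricted_divisor_pointwise :
    ∃ C : ℝ, 0 < C ∧ ∀ N : ℕ, 0 < N → ∀ h : ℤ, h ≠ 0 → |h| ≤ 2 * (N : ℤ) ^ 2 →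
      (rN N h : ℝ) ≤ C * (N : ℝ) ^ 2 *
        ∑ d ∈ h.natAbs.divisors.filter (fun d => d ≤ N), (1 : ℝ) / d := by
  refine ⟨32, by norm_num, fun N _ h hh _ => ?_⟩
  refine (Nat.cast_le.2 (rN_le_sum N hh)).trans ?_
  rw [Nat.cast_sum, Finset.mul_sum]
  refine Finset.sum_le_sum fun d _ => ?_
  have hshell : ∀ m ∈ Finset.Icc 1 (N / d), (∑ p ∈ (Finset.box m : Finset (ℤ × ℤ)) with IsCoprime p.1 p.2,
      Finset.card {v ∈ Finset.Icc (-(N : ℤ)) N ×ˢ Finset.Icc (-(N : ℤ)) N |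
        p.1 * v.1 - p.2 * v.2 = h / d}) ≤ 32 * N := by
    intro m hm
    obtain ⟨hm₁, hm₂⟩ := Finset.mem_Icc.1 hm
    have hmN : m ≤ N := hm₂.trans (Nat.div_le_self N d)
    refine Nat.le_of_mul_le_mul_left ?_ hm₁
    rw [Finset.mul_sum]
    calc _ ≤ ∑ p ∈ (Finset.box m : Finset (ℤ × ℤ)) with IsCoprime p.1 p.2, 4 * N := by
          refine Finset.sum_le_sum fun p hp => ?_
          obtain ⟨hbox, hcop⟩ := Finset.mem_filter.1 hp
          exact mul_card_line_box_le hcop hm₁ (Int.mem_box.1 hbox) _ hmN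
      _ ≤ 8 * m * (4 * N) := by
          rw [Finset.sum_const, smul_eq_mul, ← Int.card_box (by omega)]
          exact Nat.mul_le_mul_right _ (Finset.card_filter_le _ _)
      _ = m * (32 * N) := by ring
  calc _ ≤ ((N / d * (32 * N) : ℕ) : ℝ) := by
        refine Nat.cast_le.2 ((Finset.sum_le_card_nsmul _ _ _ hshell).trans ?_)
        simp
    _ ≤ (N / d : ℝ) * (32 * N) := by
        push_cast
        gcongr
        exact Nat.cast_div_le
    _ = 32 * (N : ℝ) ^ 2 * (1 / d) := by ring
end

section
/- There exists an absolute constant C > 0 such that for every integer N > 1, one has r_N(0) ≤ C·N²·log N. -/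
open Finset

/-- The integer points of sup norm `m` in the plane. -/
noncomputable def supShell (m : ℕ) : Finset (ℤ × ℤ) :=
  Icc (-m : ℤ) m ×ˢ {(m : ℤ), (-m : ℤ)} ∪ {(m : ℤ), (-m : ℤ)} ×ˢ Icc (-m : ℤ) m

lemma card_Icc_neg_self (m : ℕ) : #(Icc (-m : ℤ) m) = 2 * m + 1 := by
  rw [Int.card_Icc]
  omega

lemma card_supShell_le (m : ℕ) : #(supShell m) ≤ 4 * (2 * m + 1) := by
  have h2 : #({(m : ℤ), (-m : ℤ)} : Finset ℤ) ≤ 2 := card_le_two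
  refine (card_union_le _ _).trans ?_
  rw [card_product, card_product, card_Icc_neg_self]
  nlinarith

lemma mem_supShell_max (x y : ℤ) : (x, y) ∈ supShell (max x.natAbs y.natAbs) := by
  simp only [supShell, mem_union, mem_product, mem_Icc, mem_insert, mem_singleton]
  omega

/-- The solutions `(g x, k y, g y, k x)` of `a₁a₂ = a₃a₄` with `(x, y)` of sup norm `m`,
`1 ≤ g ≤ N / m` and `|k| ≤ N / m`. -/
noncomputable def solutionsOfSupNorm (N m : ℕ) : Finset (ℤ × ℤ × ℤ × ℤ) :=
  (Icc (1 : ℤ) (N / m : ℕ) ×ˢ Icc (-(N / m : ℕ) : ℤ) (N / m : ℕ) ×ˢ supShell m).image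
    fun p => (p.1 * p.2.2.1, p.2.1 * p.2.2.2, p.1 * p.2.2.2, p.2.1 * p.2.2.1)

lemma card_solutionsOfSupNorm_le (N m : ℕ) :
    #(solutionsOfSupNorm N m) ≤ (N / m) * ((2 * (N / m) + 1) * (4 * (2 * m + 1))) := by
  refine card_image_le.trans ?_
  rw [card_product, card_product, card_Icc_neg_self, Int.card_Icc]
  rw [add_sub_cancel_right, Int.toNat_natCast]
  gcongr
  exact card_supShell_le m

lemma card_solutionsOfSupNorm_le_div {N m : ℕ} (hm : 1 ≤ m) (hmN : m ≤ N) :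
    (#(solutionsOfSupNorm N m) : ℝ) ≤ 36 * (N : ℝ) ^ 2 * (m : ℝ)⁻¹ := by
  have hq : 1 ≤ N / m := (Nat.one_le_div_iff hm).2 hmN
  have hle : #(solutionsOfSupNorm N m) ≤ 36 * (N / m) ^ 2 * m := by
    calc _ ≤ _ := card_solutionsOfSupNorm_le N m
      _ ≤ (N / m) * ((3 * (N / m)) * (4 * (3 * m))) := by gcongr <;> omega
      _ = _ := by ring
  have hm0 : (0 : ℝ) < m := by exact_mod_cast hm
  calc (#(solutionsOfSupNorm N m) : ℝ) ≤ 36 * ((N / m : ℕ) : ℝ) ^ 2 * m := by exact_mod_cast hle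
    _ ≤ 36 * ((N : ℝ) / m) ^ 2 * m := by gcongr; exact Nat.cast_div_le
    _ = _ := by field_simp

/-- Every solution of `a b = c d` with `(a, c) ≠ 0` has the form `(g x, k y, g y, k x)`. -/
lemma exists_param_of_mul_eq_mul {a b c d : ℤ} (h : a * b = c * d) (hac : a ≠ 0 ∨ c ≠ 0) :
    ∃ g k x y : ℤ, 0 < g ∧ (x ≠ 0 ∨ y ≠ 0) ∧ a = g * x ∧ b = k * y ∧ c = g * y ∧ d = k * x := by
  have hg : 0 < Int.gcd a c := Int.gcd_pos_iff.2 hac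
  obtain ⟨x, y, hxy, hx, hy⟩ := Int.exists_gcd_one hg
  have hg' : (0 : ℤ) < Int.gcd a c := by exact_mod_cast hg
  generalize (Int.gcd a c : ℤ) = g at hx hy hg'
  have hcop : IsCoprime x y := Int.isCoprime_iff_gcd_eq_one.2 hxy
  have hne : x ≠ 0 ∨ y ≠ 0 := by
    by_contra! h0
    simp [h0.1, h0.2] at hxy
  have hxb : x * b = y * d := by
    apply mul_left_cancel₀ hg'.ne'
    rw [hx, hy] at h
    linarith
  obtain ⟨k, rfl⟩ : y ∣ b := hcop.symm.dvd_of_dvd_mul_left ⟨d, hxb⟩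
  obtain ⟨l, rfl⟩ : x ∣ d := hcop.dvd_of_dvd_mul_left ⟨y * k, hxb.symm⟩
  rcases eq_or_ne x 0 with rfl | hx0
  · exact ⟨g, k, 0, y, hg', hne, by linarith, by ring, by linarith, by ring⟩
  rcases eq_or_ne y 0 with rfl | hy0
  · exact ⟨g, l, x, 0, hg', hne, by linarith, by ring, by linarith, by ring⟩
  have hkl : k = l := by
    apply mul_left_cancel₀ (mul_ne_zero hx0 hy0)
    linarith
  subst hkl
  exact ⟨g, k, x, y, hg', hne, by linarith, by ring, by linarith, by ring⟩

lemma natAbs_le_div_of_abs_mul_le {N : ℕ} {g x y : ℤ} (hxy : x ≠ 0 ∨ y ≠ 0)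
    (hx : |g * x| ≤ N) (hy : |g * y| ≤ N) : g.natAbs ≤ N / max x.natAbs y.natAbs := by
  rw [Nat.le_div_iff_mul_le (by omega)]
  rw [Int.abs_eq_natAbs, Int.natAbs_mul] at hx hy
  rcases max_choice x.natAbs y.natAbs with h | h <;> rw [h]
  · exact_mod_cast hx
  · exact_mod_cast hy

/-- The quadruples `(0, b, 0, d)` with `|b|, |d| ≤ N`. -/
noncomputable def degenerateSolutions (N : ℕ) : Finset (ℤ × ℤ × ℤ × ℤ) :=
  (Icc (-N : ℤ) N ×ˢ Icc (-N : ℤ) N).image fun p => (0, p.1, 0, p.2)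

lemma rN_zero_le (N : ℕ) :
    rN N 0 ≤ (2 * N + 1) ^ 2 + ∑ m ∈ Icc 1 N, #(solutionsOfSupNorm N m) := by
  have hsub : {a : ℤ × ℤ × ℤ × ℤ |
      |a.1| ≤ (N : ℤ) ∧ |a.2.1| ≤ (N : ℤ) ∧ |a.2.2.1| ≤ (N : ℤ) ∧ |a.2.2.2| ≤ (N : ℤ) ∧
      a.1 * a.2.1 - a.2.2.1 * a.2.2.2 = 0} ⊆
      (degenerateSolutions N ∪ (Icc 1 N).biUnion (solutionsOfSupNorm N) :
        Finset (ℤ × ℤ × ℤ × ℤ)) := by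
    rintro ⟨a, b, c, d⟩ ⟨ha, hb, hc, hd, h⟩
    simp only at ha hb hc hd h
    rw [mem_coe, mem_union]
    by_cases hac : a ≠ 0 ∨ c ≠ 0
    · right
      obtain ⟨g, k, x, y, hg, hxy, rfl, rfl, rfl, rfl⟩ :=
        exists_param_of_mul_eq_mul (sub_eq_zero.1 h) hac
      have hgq := natAbs_le_div_of_abs_mul_le hxy ha hc
      have hkq := natAbs_le_div_of_abs_mul_le hxy hd hb
      have hmpos : 0 < max x.natAbs y.natAbs := by omega
      have hmN : max x.natAbs y.natAbs ≤ N := (Nat.one_le_div_iff hmpos).1 (by omega)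
      rw [mem_biUnion]
      refine ⟨max x.natAbs y.natAbs, mem_Icc.2 ⟨hmpos, hmN⟩,
        mem_image.2 ⟨(g, k, x, y), ?_, rfl⟩⟩
      simp only [mem_product, mem_supShell_max, and_true, mem_Icc]
      generalize N / max x.natAbs y.natAbs = q at *
      omega
    · left
      push Not at hac
      obtain ⟨rfl, rfl⟩ := hac
      exact mem_image.2 ⟨(b, d), mem_product.2 ⟨mem_Icc.2 (abs_le.1 hb), mem_Icc.2 (abs_le.1 hd)⟩,
        rfl⟩
  calc rN N 0 ≤ #(degenerateSolutions N ∪ (Icc 1 N).biUnion (solutionsOfSupNorm N)) := by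
        rw [← Set.ncard_coe_finset]
        exact Set.ncard_le_ncard hsub (finite_toSet _)
    _ ≤ #(degenerateSolutions N) + #((Icc 1 N).biUnion (solutionsOfSupNorm N)) :=
        card_union_le _ _
    _ ≤ _ := by
        refine add_le_add (card_image_le.trans ?_) card_biUnion_le
        rw [card_product, card_Icc_neg_self, sq]

theorem restricted_divisor_zero :
    ∃ C : ℝ, 0 < C ∧ ∀ N : ℕ, 1 < N →
      (rN N 0 : ℝ) ≤ C * (N : ℝ) ^ 2 * Real.log N := by
  refine ⟨126, by norm_num, fun N hN => ?_⟩
  have hN2 : (2 : ℝ) ≤ N := by exact_mod_cast hN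
  have hlog : 1 / 2 ≤ Real.log N :=
    (by linarith [Real.log_two_gt_d9] : 1 / 2 ≤ Real.log 2).trans
      (Real.log_le_log (by norm_num) hN2)
  have hharm : ∑ m ∈ Icc 1 N, (m : ℝ)⁻¹ ≤ 1 + Real.log N := by
    have h := harmonic_le_one_add_log N
    rw [harmonic_eq_sum_Icc] at h
    push_cast at h
    exact h
  calc (rN N 0 : ℝ)
      ≤ (2 * N + 1) ^ 2 + ∑ m ∈ Icc 1 N, (#(solutionsOfSupNorm N m) : ℝ) := by
        exact_mod_cast rN_zero_le N
    _ ≤ (3 * N) ^ 2 + ∑ m ∈ Icc 1 N, 36 * (N : ℝ) ^ 2 * (m : ℝ)⁻¹ := by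
        gcongr with m hm
        · linarith
        · exact card_solutionsOfSupNorm_le_div (mem_Icc.1 hm).1 (mem_Icc.1 hm).2
    _ ≤ (3 * N) ^ 2 + 36 * (N : ℝ) ^ 2 * (1 + Real.log N) := by
        rw [← mul_sum]
        gcongr
    _ ≤ 126 * (N : ℝ) ^ 2 * Real.log N := by
        nlinarith [mul_le_mul_of_nonneg_left hlog (sq_nonneg (N : ℝ))]
end
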